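/- arXiv:0710.5565 — 3 statements merged into one kernel-verified Lean document; each statement's English description precedes it below -/
import Mathlib

section
/- If R is a right noetherian and left ℵ₀-injective ring, then R is semiprimary; that is, the Jacobson radical J of R is nilpotent and R/J is a semisimple ring. -/
/-- A ring `R` is *left ℵ₀-injective* if every homomorphism of left `R`-modules
from a countably generated left ideal of `R` to `R` extends to a homomorphism of
left `R`-modules `R → R`. -/
def IsLeftAleph0Injective (R : Type*) [Ring R] : Prop :=
  ∀ I : Submodule R R,
    (∃ S : Set R, S.Countable ∧ Submodule.span R S = I) →
    ∀ f : I →ₗ[R] R, ∃ g : R →ₗ[R] R, ∀ x : I, g (x : R) = f x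

/-- The Jacobson radical `J` of a ring `R`, as a two-sided ideal. -/
def jacobsonRadical (R : Type*) [Ring R] : TwoSidedIdeal R :=
  TwoSidedIdeal.jacobson (⊥ : TwoSidedIdeal R)

namespace Aleph0Proof

section
variable {R : Type*} [Ring R]

/-- The left annihilator of `x` is an essential left ideal. -/
def LEss (x : R) : Prop := ∀ b : R, b ≠ 0 → ∃ r : R, r * b ≠ 0 ∧ r * b * x = 0

theorem factor (hinj : IsLeftAleph0Injective R) {M : Type*} [AddCommGroup M] [Module R M]
    (hM : ∃ S : Set M, S.Countable ∧ Submodule.span R S = ⊤) (φ ψ : M →ₗ[R] R)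
    (hker : ∀ m, φ m = 0 → ψ m = 0) : ∃ c : R, ∀ m, ψ m = φ m * c := by
  obtain ⟨S, hS, hspan⟩ := hM
  have hle : LinearMap.ker φ ≤ LinearMap.ker ψ := fun m hm => by
    simpa using hker m (by simpa using hm)
  obtain ⟨g, hg⟩ := hinj (LinearMap.range φ)
    ⟨φ '' S, hS.image _, by rw [Submodule.span_image, hspan, LinearMap.range_eq_map]⟩
    (((LinearMap.ker φ).liftQ ψ hle).comp φ.quotKerEquivRange.symm.toLinearMap)
  refine ⟨g 1, fun m => ?_⟩
  have h1 := hg ⟨φ m, LinearMap.mem_range_self φ m⟩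
  have h2 : φ.quotKerEquivRange.symm ⟨φ m, LinearMap.mem_range_self φ m⟩
      = Submodule.Quotient.mk m := by
    rw [LinearEquiv.symm_apply_eq]; rfl
  simp only [LinearMap.comp_apply, LinearEquiv.coe_coe, h2] at h1
  have h3 : g (φ m) = φ m * g 1 := by
    rw [← smul_eq_mul, ← map_smul, smul_eq_mul, mul_one]
  rw [← h3, h1]; rfl

theorem pinj (hinj : IsLeftAleph0Injective R) (a b : R)
    (h : ∀ m : R, m * a = 0 → m * b = 0) : ∃ c, b = a * c := by
  obtain ⟨c, hc⟩ := factor hinj (M := R)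
    ⟨{1}, Set.countable_singleton _, Ideal.span_singleton_one⟩
    (LinearMap.toSpanSingleton R R a) (LinearMap.toSpanSingleton R R b)
    (by simpa [LinearMap.toSpanSingleton_apply] using h)
  exact ⟨c, by simpa [LinearMap.toSpanSingleton_apply] using hc 1⟩

theorem LEss.mul_right {x : R} (h : LEss x) (c : R) : LEss (x * c) := fun b hb => by
  obtain ⟨r, h1, h2⟩ := h b hb
  exact ⟨r, h1, by rw [← mul_assoc, h2, zero_mul]⟩

theorem LEss.mul_left {x : R} (h : LEss x) (y : R) : LEss (y * x) := fun b hb => by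
  by_cases hby : b * y = 0
  · exact ⟨1, by simpa using hb, by rw [one_mul, ← mul_assoc, hby, zero_mul]⟩
  · obtain ⟨r, h1, h2⟩ := h _ hby
    refine ⟨r, fun h0 => h1 (by rw [← mul_assoc, h0, zero_mul]), ?_⟩
    simpa [mul_assoc] using h2

theorem LEss.neg {x : R} (h : LEss x) : LEss (-x) := by
  simpa using h.mul_right (-1)

theorem LEss.rinv (hinj : IsLeftAleph0Injective R) {x : R} (h : LEss x) :
    ∃ c, (1 + x) * c = 1 := by
  obtain ⟨c, hc⟩ := pinj hinj (1 + x) 1 (fun m hm => by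
    by_contra hne
    rw [mul_one] at hne
    obtain ⟨r, h1, h2⟩ := h m hne
    apply h1
    have : r * (m * (1 + x)) = r * m + r * m * x := by noncomm_ring
    rw [hm, h2] at this
    simpa using this.symm)
  exact ⟨c, hc.symm⟩

theorem mem_J {x : R} : x ∈ jacobsonRadical R ↔ ∀ y, ∃ z, z * y * x + z = 1 := by
  simp [jacobsonRadical, TwoSidedIdeal.mem_jacobson_iff, sub_eq_zero, TwoSidedIdeal.mem_bot]

theorem LEss.mem (hinj : IsLeftAleph0Injective R) {x : R} (h : LEss x) :
    x ∈ jacobsonRadical R := by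
  rw [mem_J]
  intro y
  obtain ⟨c, hc⟩ := (h.mul_left y).rinv hinj
  obtain ⟨d, hd⟩ := (((h.mul_left y).mul_right c).neg).rinv hinj
  have h1 : 1 + -(y * x * c) = c := by
    have : (1 + y * x) * c = c + y * x * c := by noncomm_ring
    rw [hc] at this
    rw [this]; abel
  rw [h1] at hd
  have h2 : d = 1 + y * x := by
    calc d = ((1 + y * x) * c) * d := by rw [hc, one_mul]
      _ = (1 + y * x) * (c * d) := by rw [mul_assoc]
      _ = _ := by rw [hd, mul_one]
  refine ⟨c, ?_⟩
  rw [h2] at hd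
  rw [← hd]; noncomm_ring

theorem LEss.of_mem (hinj : IsLeftAleph0Injective R) {a : R} (h : a ∈ jacobsonRadical R) :
    LEss a := by
  intro b hb
  by_contra! hcon
  obtain ⟨c, hc⟩ := pinj hinj (b * a) b (fun m hm => by
    by_contra hne
    exact hcon m hne (by rw [mul_assoc, hm]))
  apply hb
  have hac : a * c ∈ jacobsonRadical R := TwoSidedIdeal.mul_mem_right _ _ _ h
  obtain ⟨z, hz⟩ := mem_J.1 hac (-1)
  obtain ⟨w, hw⟩ := mem_J.1 hac z
  have e1 : z * (1 - a * c) = 1 := by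
    refine Eq.trans ?_ hz
    noncomm_ring
  have e3 : z = z * (a * c) + 1 := by
    have : z * (1 - a * c) = z - z * (a * c) := by noncomm_ring
    rw [e1] at this; rw [this]; abel
  have e2 : w * z = 1 := by
    rw [← hw]; nth_rewrite 1 [e3]; noncomm_ring
  have e4 : w = 1 - a * c := by
    calc w = w * (z * (1 - a * c)) := by rw [e1, mul_one]
      _ = (w * z) * (1 - a * c) := by rw [mul_assoc]
      _ = _ := by rw [e2, one_mul]
  have e5 : b * (1 - a * c) = 0 := by
    rw [mul_sub, mul_one, ← mul_assoc, ← hc, sub_self]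
  calc b = b * (w * z) := by rw [e2, mul_one]
    _ = b * (1 - a * c) * z := by rw [e4, mul_assoc]
    _ = 0 := by rw [e5, zero_mul]

/-- The right annihilator of a set. -/
def rann (S : Set R) : Submodule Rᵐᵒᵖ R where
  carrier := {r | ∀ s ∈ S, s * r = 0}
  zero_mem' := by simp
  add_mem' := by
    intro a b ha hb s hs
    rw [mul_add, ha s hs, hb s hs, add_zero]
  smul_mem' := by
    intro c x hx s hs
    rw [MulOpposite.smul_eq_mul_unop, ← mul_assoc, hx s hs, zero_mul]

theorem no_inf [IsNoetherian Rᵐᵒᵖ R] (hinj : IsLeftAleph0Injective R)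
    (K : ℕ → Submodule R R) (hK : Monotone K) (x : ℕ → R) (hx : ∀ n, x n ∈ K (n + 1))
    (hne : ∀ n, x n ≠ 0) (hd : ∀ n, Disjoint (Submodule.span R {x n}) (K n)) : False := by
  have indep : ∀ c : ℕ →₀ R, Finsupp.linearCombination R x c = 0 → ∀ i, c i * x i = 0 := by
    intro c hc
    by_contra! hcon
    have hfin : {i | c i * x i ≠ 0}.Finite := by
      apply (c.support.finite_toSet).subset
      intro i hi
      simp only [Finset.mem_coe, Finsupp.mem_support_iff]
      intro h0
      exact hi (by rw [h0, zero_mul])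
    obtain ⟨i, hi, hmax⟩ := Set.exists_max_image _ id hfin hcon
    apply hi
    have hic : i ∈ c.support := by
      rw [Finsupp.mem_support_iff]; intro h0; exact hi (by rw [h0, zero_mul])
    rw [Finsupp.linearCombination_apply, Finsupp.sum, ← Finset.add_sum_erase _ _ hic] at hc
    have hmem : ∑ j ∈ c.support.erase i, c j • x j ∈ K i := by
      refine Submodule.sum_mem _ fun j hj => ?_
      rcases lt_or_ge j i with hji | hji
      · exact Submodule.smul_mem _ _ (hK (Nat.succ_le_of_lt hji) (hx j))
      · have hlt : i < j := lt_of_le_of_ne hji (Finset.ne_of_mem_erase hj).symm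
        have : c j • x j = 0 := by
          by_contra hne'
          exact absurd (hmax j hne') (not_le.2 hlt)
        rw [this]; exact Submodule.zero_mem _
    have h1 : c i * x i ∈ K i := by
      rw [← smul_eq_mul, eq_neg_of_add_eq_zero_left hc]
      exact Submodule.neg_mem _ hmem
    exact Submodule.disjoint_def.1 (hd i) _
      (Submodule.smul_mem _ (c i) (Submodule.mem_span_singleton_self _)) h1
  have hcg : ∃ S : Set (ℕ →₀ R), S.Countable ∧ Submodule.span R S = ⊤ :=
    ⟨Set.range fun i : ℕ => Finsupp.single i 1, Set.countable_range _, by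
      simpa using (Finsupp.basisSingleOne (R := R) (ι := ℕ)).span_eq⟩
  have proj : ∀ k, ∃ c, x k * c = x k ∧ ∀ n, n ≠ k → x n * c = 0 := by
    intro k
    obtain ⟨c, hc⟩ := factor hinj hcg (Finsupp.linearCombination R x)
      ((LinearMap.toSpanSingleton R R (x k)).comp (Finsupp.lapply k))
      (fun m hm => by simpa [LinearMap.toSpanSingleton_apply] using indep m hm k)
    refine ⟨c, ?_, fun n hn => ?_⟩
    · have := hc (Finsupp.single k 1)
      simpa [LinearMap.toSpanSingleton_apply] using this.symm
    · have := hc (Finsupp.single n 1)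
      simpa [LinearMap.toSpanSingleton_apply, Finsupp.single_apply, hn] using this.symm
  let f : ℕ →o Submodule Rᵐᵒᵖ R :=
    ⟨fun k => rann (x '' Set.Ici k), fun i j hij r hr s hs =>
      hr s (Set.image_mono (Set.Ici_subset_Ici.2 hij) hs)⟩
  obtain ⟨n, hn⟩ := monotone_stabilizes_iff_noetherian.2 ‹IsNoetherian Rᵐᵒᵖ R› f
  obtain ⟨c, h1, h2⟩ := proj n
  have hc : c ∈ f (n + 1) := by
    rintro _ ⟨m, hm, rfl⟩
    exact h2 m (by have : n + 1 ≤ m := hm; omega)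
  rw [← hn (n + 1) (Nat.le_succ n)] at hc
  exact hne n (by rw [← h1]; exact hc _ ⟨n, le_refl n, rfl⟩)

theorem exists_compl [IsNoetherian Rᵐᵒᵖ R] (hinj : IsLeftAleph0Injective R)
    (L : Submodule R R) : ∃ K : Submodule R R, K.FG ∧ Disjoint K L ∧
      ∀ x, x ≠ 0 → ¬ Disjoint (Submodule.span R {x}) (L ⊔ K) := by
  by_contra! hcon
  choose! p hp0 hp using hcon
  let F : ℕ → {K : Submodule R R // K.FG ∧ Disjoint K L} := fun n =>
    Nat.rec ⟨⊥, Submodule.fg_bot, disjoint_bot_left⟩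
      (fun _ K => ⟨K.1 ⊔ Submodule.span R {p K.1},
        K.2.1.sup (Submodule.fg_span_singleton _), by
          have := hp K.1 K.2.1 K.2.2
          rw [sup_comm]
          apply Disjoint.disjoint_sup_left_of_disjoint_sup_right K.2.2
          rwa [sup_comm]⟩) n
  have hF : ∀ n, (F (n + 1)).1 = (F n).1 ⊔ Submodule.span R {p (F n).1} := fun n => rfl
  refine no_inf hinj (fun n => (F n).1) (monotone_nat_of_le_succ fun n => ?_)
    (fun n => p (F n).1) (fun n => ?_) (fun n => hp0 _ (F n).2.1 (F n).2.2) (fun n => ?_)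
  · rw [hF]; exact le_sup_left
  · rw [hF]; exact Submodule.mem_sup_right (Submodule.mem_span_singleton_self _)
  · exact (hp _ (F n).2.1 (F n).2.2).mono_right le_sup_right

theorem regular [IsNoetherian Rᵐᵒᵖ R] (hinj : IsLeftAleph0Injective R) (a : R) :
    ∃ b, a - a * b * a ∈ jacobsonRadical R := by
  obtain ⟨K, hfg, hd, hess⟩ :=
    exists_compl hinj (LinearMap.ker (LinearMap.toSpanSingleton R R a))
  obtain ⟨s, hs⟩ := (Submodule.fg_top K).2 hfg
  obtain ⟨b, hb⟩ := factor hinj (M := K) ⟨s, s.countable_toSet, hs⟩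
    ((LinearMap.toSpanSingleton R R a).comp K.subtype) K.subtype (fun m hm => by
      exact Submodule.disjoint_def.1 hd _ m.2 (by simpa using hm))
  refine ⟨b, LEss.mem hinj fun x hx => ?_⟩
  have := hess x hx
  rw [Submodule.disjoint_def] at this
  push Not at this
  obtain ⟨y, hy1, hy2, hy0⟩ := this
  obtain ⟨r, rfl⟩ := Submodule.mem_span_singleton.1 hy1
  refine ⟨r, hy0, ?_⟩
  rw [smul_eq_mul] at hy2
  obtain ⟨l, hl, k, hk, hlk⟩ := Submodule.mem_sup.1 hy2
  rw [← hlk]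
  have h1 : l * a = 0 := by simpa [LinearMap.toSpanSingleton_apply] using hl
  have h2 : k = k * a * b := by
    simpa [LinearMap.toSpanSingleton_apply] using hb ⟨k, hk⟩
  calc (l + k) * (a - a * b * a) = l * a - l * a * b * a + (k * a - k * a * b * a) := by
        noncomm_ring
    _ = 0 := by rw [h1, ← h2]; simp

theorem semisimple_of_regular (P : Type*) [Ring P] [IsNoetherianRing P]
    (h : ∀ a : P, ∃ b, a * b * a = a) : IsSemisimpleRing P := by
  have key : ∀ T : Submodule P P, ∃ e : P, e * e = e ∧ T = Submodule.span P {e} := by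
    intro T
    let A : Set (Submodule P P) := {U | U ≤ T ∧ ∃ e : P, e * e = e ∧ U = Submodule.span P {e}}
    obtain ⟨U, ⟨hUT, e, he, rfl⟩, hmax⟩ := set_has_maximal_iff_noetherian.2
      ‹IsNoetherianRing P› A ⟨⊥, bot_le, 0, by simp, by simp⟩
    refine ⟨e, he, le_antisymm (fun t ht => ?_) hUT⟩
    have heT : e ∈ T := hUT (Submodule.mem_span_singleton_self e)
    obtain ⟨t', ht'⟩ : ∃ t', t' = t - t * e := ⟨_, rfl⟩
    have ht'T : t' ∈ T := by
      rw [ht']; exact T.sub_mem ht (T.smul_mem t heT)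
    have hte : t' * e = 0 := by rw [ht', sub_mul, mul_assoc, he, sub_self]
    obtain ⟨b, hb⟩ := h t'
    obtain ⟨f, hf⟩ : ∃ f, f = b * t' := ⟨_, rfl⟩
    have hfe : f * e = 0 := by rw [hf, mul_assoc, hte, mul_zero]
    have hff : f * f = f := by
      rw [hf, mul_assoc, ← mul_assoc t', hb]
    have htf : t' * f = t' := by rw [hf, ← mul_assoc, hb]
    have hfT : f ∈ T := by rw [hf]; exact T.smul_mem b ht'T
    obtain ⟨g, hg⟩ : ∃ g, g = e + f - e * f := ⟨_, rfl⟩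
    have heg : e * g = e := by
      rw [hg, mul_sub, mul_add, ← mul_assoc, he]; abel
    have hfg : f * g = f := by
      rw [hg, mul_sub, mul_add, ← mul_assoc, hfe, hff, zero_mul]; abel
    have hgg : g * g = g := by
      nth_rewrite 1 [hg]
      rw [sub_mul, add_mul, mul_assoc, heg, hfg, ← hg]
    have hgT : g ∈ T := by
      rw [hg]; exact T.sub_mem (T.add_mem heT hfT) (T.smul_mem e hfT)
    have hle : Submodule.span P {e} ≤ Submodule.span P {g} := by
      rw [Submodule.span_singleton_le_iff_mem, Submodule.mem_span_singleton]
      exact ⟨e, heg⟩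
    have hnot := hmax (Submodule.span P {g})
      ⟨(Submodule.span_singleton_le_iff_mem _ _).2 hgT, g, hgg, rfl⟩
    have heq : Submodule.span P {g} ≤ Submodule.span P {e} := by
      by_contra hc
      exact hnot (lt_of_le_not_ge hle hc)
    have hfm : f ∈ Submodule.span P {e} :=
      heq (Submodule.mem_span_singleton.2 ⟨f, hfg⟩)
    have : t = t' * f + t * e := by rw [htf, ht']; abel
    rw [this]
    exact Submodule.add_mem _ (Submodule.smul_mem _ t' hfm)
      (Submodule.smul_mem _ t (Submodule.mem_span_singleton_self e))
  have hcl : ComplementedLattice (Submodule P P) := by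
    refine ⟨fun T => ?_⟩
    obtain ⟨e, he, rfl⟩ := key T
    refine ⟨Submodule.span P {1 - e}, ?_, ?_⟩
    · rw [Submodule.disjoint_def]
      intro x hx hx'
      obtain ⟨u, rfl⟩ := Submodule.mem_span_singleton.1 hx
      obtain ⟨v, hv⟩ := Submodule.mem_span_singleton.1 hx'
      simp only [smul_eq_mul] at hv ⊢
      have h1 : v * (1 - e) * e = 0 := by
        rw [mul_assoc, sub_mul, one_mul, he, sub_self, mul_zero]
      rw [hv, mul_assoc, he] at h1
      exact h1
    · rw [codisjoint_iff, eq_top_iff]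
      intro x _
      have : x = x * e + x * (1 - e) := by noncomm_ring
      rw [this]
      exact Submodule.add_mem_sup
        (Submodule.smul_mem _ x (Submodule.mem_span_singleton_self _))
        (Submodule.smul_mem _ x (Submodule.mem_span_singleton_self _))
  exact (isSemisimpleModule_iff P P).2 hcl

theorem semisimple [IsNoetherian Rᵐᵒᵖ R] (hinj : IsLeftAleph0Injective R) :
    IsSemisimpleRing (jacobsonRadical R).ringCon.Quotient := by
  rw [← isSemisimpleRing_mulOpposite_iff]
  have e : R ≃ₗ[Rᵐᵒᵖ] Rᵐᵒᵖ :=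
    { MulOpposite.opAddEquiv with map_smul' := fun c x => by simp }
  have : IsNoetherianRing Rᵐᵒᵖ := isNoetherian_of_linearEquiv e
  have : IsNoetherianRing (jacobsonRadical R).ringCon.Quotientᵐᵒᵖ :=
    isNoetherianRing_of_surjective Rᵐᵒᵖ _ (RingHom.op (jacobsonRadical R).ringCon.mk') (by
      intro y
      obtain ⟨r, hr⟩ := RingCon.mk'_surjective _ y.unop
      exact ⟨MulOpposite.op r, MulOpposite.unop_injective (by simpa using hr)⟩)
  apply semisimple_of_regular
  intro a
  obtain ⟨r, hr⟩ := RingCon.mk'_surjective _ a.unop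
  obtain ⟨b, hb⟩ := regular hinj r
  refine ⟨MulOpposite.op ((jacobsonRadical R).ringCon.mk' b), MulOpposite.unop_injective ?_⟩
  have h0 : (jacobsonRadical R).ringCon.mk' (r - r * b * r) = 0 := by
    rw [← TwoSidedIdeal.mem_ker, TwoSidedIdeal.ker_ringCon_mk']
    exact hb
  rw [map_sub, sub_eq_zero, map_mul, map_mul, hr] at h0
  simp only [MulOpposite.unop_mul, MulOpposite.unop_op, ← mul_assoc]
  exact h0.symm

/-- A two-sided ideal as a right ideal. -/
def toRight (I : Ideal R) [I.IsTwoSided] : Submodule Rᵐᵒᵖ R where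
  carrier := I
  zero_mem' := I.zero_mem
  add_mem' := I.add_mem
  smul_mem' := fun c x hx => by
    rw [MulOpposite.smul_eq_mul_unop]; exact I.mul_mem_right _ hx

theorem exists_gen [IsNoetherian Rᵐᵒᵖ R] (I : Ideal R) [I.IsTwoSided] :
    ∃ s : Finset R, (∀ x ∈ s, x ∈ I) ∧
      ∀ A : Submodule Rᵐᵒᵖ R, (∀ x ∈ s, x ∈ A) → ∀ x ∈ I, x ∈ A := by
  obtain ⟨s, hs⟩ := IsNoetherian.noetherian (toRight I)
  refine ⟨s, fun x hx => ?_, fun A hA x hx => ?_⟩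
  · have : x ∈ toRight I := hs ▸ Submodule.subset_span hx
    exact this
  · have h1 : x ∈ toRight I := hx
    rw [← hs] at h1
    exact Submodule.span_le.2 hA h1

theorem ess_finset (s : Finset R) (hs : ∀ x ∈ s, LEss x) (b : R) (hb : b ≠ 0) :
    ∃ r, r * b ≠ 0 ∧ ∀ x ∈ s, r * b * x = 0 := by
  classical
  induction s using Finset.induction_on with
  | empty => exact ⟨1, by simpa using hb, by simp⟩
  | insert a s _ ih =>
    obtain ⟨r, h1, h2⟩ := ih fun x hx => hs x (Finset.mem_insert_of_mem hx)
    obtain ⟨q, h3, h4⟩ := hs a (Finset.mem_insert_self _ _) _ h1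
    refine ⟨q * r, by rwa [mul_assoc], fun x hx => ?_⟩
    rcases Finset.mem_insert.1 hx with rfl | hx
    · rwa [mul_assoc q]
    · rw [mul_assoc q, mul_assoc q, h2 x hx, mul_zero]

theorem ess_vec (E : R → Prop) (hE0 : E 0) (hEm : ∀ q x, E x → E (q * x))
    (hE : ∀ b, b ≠ 0 → ∃ r, r * b ≠ 0 ∧ E (r * b)) (s : Finset R) :
    (∃ t ∈ s, t ≠ 0) → ∃ r, (∃ t ∈ s, r * t ≠ 0) ∧ ∀ t ∈ s, E (r * t) := by
  classical
  induction s using Finset.induction_on with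
  | empty => rintro ⟨t, ht, _⟩; simp at ht
  | insert a s _ ih =>
    intro hne
    by_cases h : ∃ t ∈ s, t ≠ 0
    · obtain ⟨r, ⟨t, ht, hrt⟩, h2⟩ := ih h
      by_cases hra : r * a = 0
      · refine ⟨r, ⟨t, Finset.mem_insert_of_mem ht, hrt⟩, fun x hx => ?_⟩
        rcases Finset.mem_insert.1 hx with rfl | hx
        · rw [hra]; exact hE0
        · exact h2 x hx
      · obtain ⟨q, h3, h4⟩ := hE _ hra
        refine ⟨q * r, ⟨a, Finset.mem_insert_self _ _, by rwa [mul_assoc]⟩, fun x hx => ?_⟩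
        rw [mul_assoc]
        rcases Finset.mem_insert.1 hx with rfl | hx
        · exact h4
        · exact hEm _ _ (h2 x hx)
    · push Not at h
      obtain ⟨t, ht, ht0⟩ := hne
      have : t = a := by
        rcases Finset.mem_insert.1 ht with rfl | ht
        · rfl
        · exact absurd (h t ht) ht0
      subst this
      obtain ⟨q, h3, h4⟩ := hE _ ht0
      refine ⟨q, ⟨t, Finset.mem_insert_self _ _, h3⟩, fun x hx => ?_⟩
      rcases Finset.mem_insert.1 hx with rfl | hx
      · exact h4
      · rw [h x hx, mul_zero]; exact hE0

/-- The left annihilator of a left ideal, as a right ideal. -/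
def lann (I : Ideal R) : Submodule Rᵐᵒᵖ R where
  carrier := {r | ∀ s ∈ I, r * s = 0}
  zero_mem' := by simp
  add_mem' := by
    intro a b ha hb s hs
    rw [add_mul, ha s hs, hb s hs, add_zero]
  smul_mem' := by
    intro c x hx s hs
    rw [MulOpposite.smul_eq_mul_unop, mul_assoc]
    exact hx _ (I.mul_mem_left _ hs)

theorem nilp [IsNoetherian Rᵐᵒᵖ R] (J : Ideal R) [J.IsTwoSided]
    (hJ : ∀ x ∈ J, LEss x) : ∃ n, J ^ n = ⊥ := by
  obtain ⟨s, hsJ, hsgen⟩ := exists_gen J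
  have hE : ∀ b : R, b ≠ 0 → ∃ r, r * b ≠ 0 ∧ ∀ j ∈ J, r * b * j = 0 := by
    intro b hb
    obtain ⟨r, h1, h2⟩ := ess_finset s (fun x hx => hJ x (hsJ x hx)) b hb
    refine ⟨r, h1, fun j hj => ?_⟩
    exact hsgen (rann {r * b}) (fun x hx y hy => by
      rw [Set.mem_singleton_iff.1 hy]; exact h2 x hx) j hj _ rfl
  let f : ℕ →o Submodule Rᵐᵒᵖ R :=
    ⟨fun k => lann (J ^ k), fun i j hij r hr t ht => hr t (Ideal.pow_le_pow_right hij ht)⟩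
  obtain ⟨n, hn⟩ := monotone_stabilizes_iff_noetherian.2 ‹IsNoetherian Rᵐᵒᵖ R› f
  refine ⟨n, ?_⟩
  by_contra hne
  obtain ⟨u, huJ, hugen⟩ := exists_gen (J ^ n)
  have hu : ∃ t ∈ u, t ≠ 0 := by
    by_contra! hcon
    apply hne
    rw [eq_bot_iff]
    intro x hx
    have := hugen ⊥ (fun y hy => by simpa using hcon y hy) x hx
    simpa using this
  obtain ⟨r, ⟨t, htu, hrt⟩, hr⟩ := ess_vec (fun y => ∀ j ∈ J, y * j = 0) (by simp)
    (fun q x hx j hj => by rw [mul_assoc, hx j hj, mul_zero]) hE u hu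
  have hall : ∀ y ∈ J ^ n, ∀ j ∈ J, r * y * j = 0 := by
    intro y hy j hj
    let A : Submodule Rᵐᵒᵖ R :=
      { carrier := {y | ∀ j ∈ J, r * y * j = 0}
        zero_mem' := by simp
        add_mem' := by
          intro a b ha hb j hj
          rw [mul_add, add_mul, ha j hj, hb j hj, add_zero]
        smul_mem' := by
          intro c x hx j hj
          rw [MulOpposite.smul_eq_mul_unop, ← mul_assoc, mul_assoc (r * x)]
          exact hx _ (J.mul_mem_left _ hj) }
    exact hugen A hr y hy j hj
  have hmem : r ∈ f (n + 1) := by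
    intro z hz
    rw [Submodule.pow_succ] at hz
    refine Submodule.mul_induction_on hz (fun y hy j hj => ?_) (fun y z hy hz => ?_)
    · rw [← mul_assoc]; exact hall y hy j hj
    · rw [mul_add, hy, hz, add_zero]
  rw [← hn (n + 1) (Nat.le_succ n)] at hmem
  exact hrt (hmem t (huJ t htu))

theorem list_prod_mem (J : Ideal R) [J.IsTwoSided] (l : List R) (h : ∀ x ∈ l, x ∈ J) :
    l.prod ∈ J ^ l.length := by
  induction l with
  | nil => simp [Submodule.pow_zero]
  | cons a l ih =>
    rw [List.prod_cons, List.length_cons, Ideal.IsTwoSided.pow_succ]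
    exact Ideal.mul_mem_mul (h a (by simp)) (ih fun x hx => h x (by simp [hx]))

end

end Aleph0Proof

/-- If `R` is right noetherian (ACC on right ideals) and left ℵ₀-injective, then
`R` is semiprimary: its Jacobson radical `J` is nilpotent (some power `Jⁿ`,
`n ≥ 1`, vanishes, i.e. every product of `n` elements of `J` is zero) and `R/J`
is a semisimple ring. -/
theorem semiprimary_of_rightNoetherian_leftAleph0Injective (R : Type*) [Ring R]
    [IsNoetherian Rᵐᵒᵖ R] (hinj : IsLeftAleph0Injective R) :
    (∃ n : ℕ, 0 < n ∧ ∀ a : Fin n → R,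
        (∀ i, a i ∈ jacobsonRadical R) → (List.ofFn a).prod = 0) ∧
      IsSemisimpleRing (jacobsonRadical R).ringCon.Quotient := by
  refine ⟨?_, Aleph0Proof.semisimple hinj⟩
  let J : Ideal R := TwoSidedIdeal.asIdeal (jacobsonRadical R)
  have hJ : ∀ x, x ∈ J ↔ x ∈ jacobsonRadical R := fun x => TwoSidedIdeal.mem_asIdeal
  have : J.IsTwoSided := ⟨fun b ha => by
    rw [hJ] at ha ⊢
    exact TwoSidedIdeal.mul_mem_right _ _ _ ha⟩
  obtain ⟨n, hn⟩ := Aleph0Proof.nilp J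
    (fun x hx => Aleph0Proof.LEss.of_mem hinj ((hJ x).1 hx))
  refine ⟨n + 1, Nat.succ_pos n, fun a ha => ?_⟩
  have h1 := Aleph0Proof.list_prod_mem J (List.ofFn a) (fun x hx => by
    obtain ⟨i, rfl⟩ := List.mem_ofFn.1 hx
    exact (hJ _).2 (ha i))
  rw [List.length_ofFn] at h1
  have h2 := Ideal.pow_le_pow_right (Nat.le_succ n) h1
  rw [hn] at h2
  simpa using h2
end

section
/- If R is a right noetherian and left ℵ₀-injective ring, then R is right artinian. -/
lemma semisimple_of_regular (B : Type*) [Ring B] [IsNoetherianRing B]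
    (h : ∀ a : B, ∃ b, a * b * a = a) : IsSemisimpleRing B := by
  unfold IsSemisimpleRing
  rw [isSemisimpleModule_iff]
  refine ⟨fun I => ?_⟩
  obtain ⟨M, ⟨e, he, heI, rfl⟩, hmax⟩ := set_has_maximal_iff_noetherian.mpr
    (inferInstance : IsNoetherian B B)
    {N : Submodule B B | ∃ e : B, e * e = e ∧ e ∈ I ∧ N = Ideal.span {e}}
    ⟨_, 0, by simp, I.zero_mem, rfl⟩
  have key : ∀ x ∈ I, x * e = x := by
    intro x hx
    by_contra hne
    obtain ⟨b, hb⟩ := h (x - x * e)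
    set y := x - x * e with hy
    have hye : y * e = 0 := by rw [hy, sub_mul, mul_assoc, he, sub_self]
    have hyI : y ∈ I := I.sub_mem hx (I.smul_mem x heI)
    have hy0 : y ≠ 0 := fun h0 => hne (sub_eq_zero.mp h0).symm
    set f := b * y - e * b * y with hf
    have hyf : y * f = y := by
      rw [hf, mul_sub, ← mul_assoc, hb, ← mul_assoc, ← mul_assoc, hye]; simp
    have hfe : f * e = 0 := by
      rw [hf, sub_mul, mul_assoc, mul_assoc, hye]; simp
    have hef : e * f = 0 := by
      rw [hf, mul_sub, ← mul_assoc, ← mul_assoc, ← mul_assoc, he, sub_self]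
    have hff : f * f = f := by
      calc f * f = (b * y - e * b * y) * f := by rw [← hf]
        _ = b * (y * f) - e * b * (y * f) := by rw [sub_mul, mul_assoc, mul_assoc _ y f]
        _ = f := by rw [hyf]
    have hfI : f ∈ I := I.sub_mem (I.smul_mem b hyI) (I.smul_mem (e * b) hyI)
    refine hmax (Ideal.span {e + f}) ⟨e + f, ?_, I.add_mem heI hfI, rfl⟩ ?_
    · rw [add_mul, mul_add, mul_add, he, hff, hef, hfe]; simp
    · refine lt_of_le_of_ne ?_ ?_
      · refine (Ideal.span_singleton_le_iff_mem _).mpr (Ideal.mem_span_singleton'.mpr ⟨e, ?_⟩)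
        rw [mul_add, he, hef, add_zero]
      · intro heq
        have : y ∈ Ideal.span {e} := by
          rw [heq]
          refine Ideal.mem_span_singleton'.mpr ⟨y, ?_⟩
          rw [mul_add, hye, hyf, zero_add]
        obtain ⟨c, hc⟩ := Ideal.mem_span_singleton'.mp this
        apply hy0
        have h1 : y * e = y := by rw [← hc, mul_assoc, he]
        rw [← h1, hye]
  refine ⟨Ideal.span {1 - e}, ?_⟩
  constructor
  · rw [Submodule.disjoint_def]
    intro x hx hx'
    obtain ⟨c, rfl⟩ := Ideal.mem_span_singleton'.mp hx'
    rw [← key _ hx, mul_assoc, sub_mul, he]; simp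
  · rw [codisjoint_iff, Ideal.eq_top_iff_one]
    exact Submodule.mem_sup.mpr ⟨e, heI, 1 - e, Ideal.mem_span_singleton_self _, by simp⟩

/-- The (right) singular ideal. -/
def singZ (S : Type*) [Ring S] : Ideal S where
  carrier := {a | ∀ x : S, x ≠ 0 → ∃ r, x * r ≠ 0 ∧ a * (x * r) = 0}
  zero_mem' := fun x hx => ⟨1, by simpa using hx, by simp⟩
  add_mem' := by
    intro a b ha hb x hx
    obtain ⟨r, h1, h2⟩ := ha x hx
    obtain ⟨s, h3, h4⟩ := hb _ h1
    refine ⟨r * s, by rwa [← mul_assoc], ?_⟩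
    rw [← mul_assoc x, add_mul, h4, ← mul_assoc, h2]; simp
  smul_mem' := by
    intro c a ha x hx
    obtain ⟨r, h1, h2⟩ := ha x hx
    exact ⟨r, h1, by rw [smul_eq_mul, mul_assoc, h2, mul_zero]⟩

lemma mem_singZ {S : Type*} [Ring S] {a : S} :
    a ∈ singZ S ↔ ∀ x : S, x ≠ 0 → ∃ r, x * r ≠ 0 ∧ a * (x * r) = 0 := Iff.rfl

instance (S : Type*) [Ring S] : (singZ S).IsTwoSided := by
  refine ⟨fun {a} b ha => ?_⟩
  rw [mem_singZ] at *
  intro x hx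
  by_cases h0 : b * x = 0
  · exact ⟨1, by simpa using hx, by rw [mul_one, mul_assoc, h0, mul_zero]⟩
  · obtain ⟨r, h1, h2⟩ := ha _ h0
    refine ⟨r, fun h => h1 (by rw [mul_assoc, h, mul_zero]), ?_⟩
    rw [← h2]; simp only [mul_assoc]

lemma singZ_common (S : Type*) [Ring S] [IsNoetherianRing S] (x : S) (hx : x ≠ 0) :
    ∃ r, x * r ≠ 0 ∧ ∀ z ∈ singZ S, z * (x * r) = 0 := by
  classical
  obtain ⟨T, hT⟩ := (IsNoetherian.noetherian (singZ S) : (singZ S).FG)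
  have key : ∀ T : Finset S, (∀ z ∈ T, z ∈ singZ S) →
      ∃ r, x * r ≠ 0 ∧ ∀ z ∈ T, z * (x * r) = 0 := by
    intro T
    induction T using Finset.induction_on with
    | empty => exact fun _ => ⟨1, by simpa using hx, by simp⟩
    | insert a T _ ih =>
      intro hT
      obtain ⟨r, h1, h2⟩ := ih fun z hz => hT z (Finset.mem_insert_of_mem hz)
      obtain ⟨s, h3, h4⟩ := hT a (Finset.mem_insert_self _ _) _ h1
      refine ⟨r * s, by rwa [← mul_assoc], fun z hz => ?_⟩
      rcases Finset.mem_insert.mp hz with rfl | hz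
      · rwa [← mul_assoc x]
      · rw [← mul_assoc x, ← mul_assoc, h2 z hz, zero_mul]
  obtain ⟨r, h1, h2⟩ := key T fun z hz => hT ▸ Submodule.subset_span hz
  refine ⟨r, h1, fun z hz => ?_⟩
  rw [← hT] at hz
  induction hz using Submodule.span_induction with
  | mem z hz => exact h2 z hz
  | zero => simp
  | add a b _ _ ha hb => rw [add_mul, ha, hb, add_zero]
  | smul c a _ ha => rw [smul_eq_mul, mul_assoc, ha, mul_zero]

lemma singZ_common_finset (S : Type*) [Ring S] [IsNoetherianRing S] (x : S) (hx : x ≠ 0)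
    (B : Finset S) :
    ∃ r, (∃ y, (y = x ∨ y ∈ B) ∧ y * r ≠ 0) ∧ ∀ b ∈ B, ∀ z ∈ singZ S, z * (b * r) = 0 := by
  classical
  induction B using Finset.induction_on with
  | empty => exact ⟨1, ⟨x, Or.inl rfl, by simpa using hx⟩, by simp⟩
  | insert a B _ ih =>
    obtain ⟨r, ⟨y, hy, hyr⟩, h2⟩ := ih
    by_cases h0 : a * r = 0
    · refine ⟨r, ⟨y, hy.imp id Finset.mem_insert_of_mem, hyr⟩, fun b hb z hz => ?_⟩
      rcases Finset.mem_insert.mp hb with rfl | hb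
      · rw [h0, mul_zero]
      · exact h2 b hb z hz
    · obtain ⟨s, h3, h4⟩ := singZ_common S _ h0
      refine ⟨r * s, ⟨a, Or.inr (Finset.mem_insert_self _ _), by rwa [← mul_assoc]⟩,
        fun b hb z hz => ?_⟩
      rcases Finset.mem_insert.mp hb with rfl | hb
      · rw [← mul_assoc b]; exact h4 z hz
      · rw [← mul_assoc b, ← mul_assoc, h2 b hb z hz, zero_mul]

lemma singZ_nilpotent (S : Type*) [Ring S] [IsNoetherianRing S] :
    ∃ n, (singZ S) ^ n = ⊥ := by
  classical
  have hle : ∀ n, singZ S ^ (n + 1) ≤ singZ S ^ n := fun n => by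
    rw [Ideal.IsTwoSided.pow_succ]; exact Ideal.mul_le_right
  let A : ℕ →o Submodule S S :=
    { toFun := fun n =>
        { carrier := {x | ∀ z ∈ singZ S ^ n, z * x = 0}
          zero_mem' := fun z _ => mul_zero z
          add_mem' := fun {a b} ha hb z hz => by rw [mul_add, ha z hz, hb z hz, add_zero]
          smul_mem' := fun c a ha z hz => by
            rw [smul_eq_mul, ← mul_assoc]
            exact ha _ (Ideal.mul_mem_right c _ hz) }
      monotone' := monotone_nat_of_le_succ fun n x hx z hz => hx z (hle n hz) }
  obtain ⟨n, hn⟩ := monotone_stabilizes_iff_noetherian.mpr (inferInstance : IsNoetherian S S) A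
  refine ⟨n, ?_⟩
  by_contra hne
  obtain ⟨B, hB⟩ := (IsNoetherian.noetherian (singZ S ^ n) : (singZ S ^ n).FG)
  obtain ⟨x, hxB, hx0⟩ : ∃ x ∈ B, x ≠ 0 := by
    by_contra! hall
    apply hne
    rw [← hB]
    exact Submodule.span_eq_bot.mpr hall
  obtain ⟨r, ⟨y, hy, hyr⟩, h⟩ := singZ_common_finset S x hx0 B
  have hyB : y ∈ B := by rcases hy with rfl | hy <;> assumption
  have h' : ∀ w ∈ singZ S ^ n, ∀ z ∈ singZ S, z * (w * r) = 0 := by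
    intro w hw
    rw [← hB] at hw
    induction hw using Submodule.span_induction with
    | mem b hb => exact h b hb
    | zero => simp
    | add a b _ _ ha hb =>
      intro z hz
      rw [add_mul, mul_add, ha z hz, hb z hz, add_zero]
    | smul c a _ ha =>
      intro z hz
      rw [smul_eq_mul, mul_assoc, ← mul_assoc z]
      exact ha _ (Ideal.mul_mem_right c _ hz)
  have hr : r ∈ A (n + 1) := by
    intro z hz
    rw [Ideal.IsTwoSided.pow_succ] at hz
    refine Submodule.mul_induction_on hz ?_ ?_
    · intro a ha b hb
      rw [mul_assoc]; exact h' b hb a ha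
    · intro a b ha hb; rw [add_mul, ha, hb, add_zero]
  rw [← hn (n + 1) (Nat.le_succ n)] at hr
  exact hyr (hr y (hB ▸ Submodule.subset_span hyB))

lemma artinian_of_regular_mod_sing (S : Type*) [Ring S] [IsNoetherianRing S]
    (h : ∀ a : S, ∃ b, a - a * b * a ∈ singZ S) : IsArtinianRing S := by
  obtain ⟨n, hn⟩ := singZ_nilpotent S
  have hmem : ∀ x : S, x ∈ Ring.jacobson S ↔ ∀ y, ∃ z, z * y * x + z = 1 := by
    intro x
    rw [← Ideal.jacobson_bot, Ideal.mem_jacobson_iff]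
    simp [sub_eq_zero]
  have hpow : ∀ x ∈ singZ S, ∀ m, x ^ m ∈ singZ S ^ m := by
    intro x hx m
    induction m with
    | zero => rw [Submodule.pow_zero, Ideal.one_eq_top]; trivial
    | succ m ih => rw [Ideal.IsTwoSided.pow_succ, pow_succ']; exact Submodule.mul_mem_mul hx ih
  have h1 : singZ S ≤ Ring.jacobson S := by
    intro x hx
    rw [hmem]
    intro y
    have hnil : IsNilpotent (y * x) := ⟨n, by
      have := hpow _ ((singZ S).mul_mem_left y hx) n
      rwa [hn, Submodule.mem_bot] at this⟩
    obtain ⟨u, hu⟩ := hnil.isUnit_one_add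
    refine ⟨(↑u⁻¹ : S), ?_⟩
    have : (↑u⁻¹ : S) * (1 + y * x) = 1 := by rw [← hu]; simp
    rw [← this]; noncomm_ring
  have h2 : Ring.jacobson S ≤ singZ S := by
    intro a ha
    obtain ⟨b, hb⟩ := h a
    obtain ⟨z, hz⟩ := (hmem (a * b)).mp (Ideal.mul_mem_right b _ ha) (-1)
    have := (singZ S).mul_mem_left z hb
    have e : z * (a - a * b * a) = a := by
      calc z * (a - a * b * a) = (z * -1 * (a * b) + z) * a := by noncomm_ring
        _ = a := by rw [hz, one_mul]
    rwa [e] at this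
  have hJ := le_antisymm h2 h1
  have : IsSemiprimaryRing S := by
    refine ⟨?_, n, by rw [hJ, hn]; rfl⟩
    have := isNoetherianRing_of_surjective S (S ⧸ Ring.jacobson S) (Ideal.Quotient.mk _)
      Ideal.Quotient.mk_surjective
    apply semisimple_of_regular
    intro a
    obtain ⟨a, rfl⟩ := Ideal.Quotient.mk_surjective a
    obtain ⟨b, hb⟩ := h a
    refine ⟨Ideal.Quotient.mk _ b, ?_⟩
    rw [← map_mul, ← map_mul, eq_comm, Ideal.Quotient.eq]
    exact h1 hb
  exact IsSemiprimaryRing.isNoetherian_iff_isArtinian.mp ‹_›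

lemma ext_of_inj {R : Type*} [Ring R] (hinj : IsLeftAleph0Injective R)
    {M : Type*} [AddCommGroup M] [Module R M] (φ ψ : M →ₗ[R] R) (hφ : Function.Injective φ)
    (hc : ∃ s : Set R, s.Countable ∧ Submodule.span R s = LinearMap.range φ) :
    ∃ b : R, ∀ m, φ m * b = ψ m := by
  obtain ⟨g, hg⟩ := hinj _ hc (ψ ∘ₗ (LinearEquiv.ofInjective φ hφ).symm.toLinearMap)
  refine ⟨g 1, fun m => ?_⟩
  have := hg (LinearEquiv.ofInjective φ hφ m)
  simp only [LinearMap.comp_apply, LinearEquiv.coe_coe, LinearEquiv.symm_apply_apply,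
    LinearEquiv.ofInjective_apply] at this
  rw [← this, ← smul_eq_mul, ← map_smul, smul_eq_mul, mul_one]

/-- No infinite sequence of independent left ideals. -/
lemma no_seq {R : Type*} [Ring R] [IsNoetherian Rᵐᵒᵖ R] (hinj : IsLeftAleph0Injective R)
    (k : ℕ → R) (hk : ∀ n, k n ≠ 0) (K : ℕ → Submodule R R)
    (hKk : ∀ i n, i < n → k i ∈ K n) (hd : ∀ n, Disjoint (K n) (Submodule.span R {k n})) :
    False := by
  have hdis : ∀ n, Disjoint (Submodule.span R {k n}) (Submodule.span R (k '' Set.Ioi n)) := by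
    intro n
    have hU : Submodule.span R (k '' Set.Ioi n) =
        ⨆ m, Submodule.span R (k '' Set.Ioo n m) := by
      rw [← Submodule.span_iUnion, ← Set.image_iUnion]
      congr 2
      ext i
      simp only [Set.mem_Ioi, Set.mem_iUnion, Set.mem_Ioo]
      exact ⟨fun h => ⟨i + 1, h, by omega⟩, fun ⟨_, h, _⟩ => h⟩
    have hmono : Monotone fun m => Submodule.span R (k '' Set.Ioo n m) := fun a b hab =>
      Submodule.span_mono (Set.image_mono (Set.Ioo_subset_Ioo_right hab))
    rw [hU, hmono.directed_le.disjoint_iSup_right]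
    intro m
    induction m with
    | zero => simp
    | succ m ih =>
      by_cases hnm : n < m
      · have : Set.Ioo n (m + 1) = Set.Ioo n m ∪ {m} := by
          ext i; simp only [Set.mem_Ioo, Set.mem_union, Set.mem_singleton_iff]; omega
        rw [this, Set.image_union, Set.image_singleton, Submodule.span_union]
        refine ih.disjoint_sup_right_of_disjoint_sup_left ((hd m).mono_left ?_)
        rw [sup_le_iff, Submodule.span_le, Submodule.span_le]
        constructor
        · rintro _ rfl; exact hKk _ _ hnm
        · rintro _ ⟨i, hi, rfl⟩; exact hKk _ _ hi.2
      · have : Set.Ioo n (m + 1) = ∅ := by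
          ext i; simp only [Set.mem_Ioo, Set.mem_empty_iff_false, iff_false]; omega
        rw [this]; simp
  have hE : ∀ n, ∃ e : R, k n * e = k n ∧ ∀ i, n < i → k i * e = 0 := by
    intro n
    set P := Submodule.span R {k n}
    set Q := Submodule.span R (k '' Set.Ioi n)
    obtain ⟨e, he⟩ := ext_of_inj hinj (P.subtype.coprod Q.subtype)
      (P.subtype ∘ₗ LinearMap.fst R P Q) (by
        rw [← LinearMap.ker_eq_bot, LinearMap.ker_eq_bot']
        rintro ⟨p, q⟩ hpq
        simp only [LinearMap.coprod_apply, Submodule.subtype_apply] at hpq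
        have hp : (p : R) = 0 := Submodule.disjoint_def.mp (hdis n) _ p.2 (by
          rw [eq_neg_of_add_eq_zero_left hpq]; exact Q.neg_mem q.2)
        have hq : (q : R) = 0 := by rwa [hp, zero_add] at hpq
        exact Prod.ext (Subtype.ext hp) (Subtype.ext hq))
      ⟨{k n} ∪ k '' Set.Ioi n,
        (Set.countable_singleton _).union ((Set.to_countable _).image _), by
        rw [Submodule.span_union, LinearMap.range_coprod, Submodule.range_subtype,
          Submodule.range_subtype]⟩
    refine ⟨e, ?_, fun i hi => ?_⟩
    · have := he (⟨k n, Submodule.mem_span_singleton_self _⟩, 0)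
      simpa using this
    · have := he (0, ⟨k i, Submodule.subset_span ⟨i, hi, rfl⟩⟩)
      simpa using this
  let A : ℕ →o Submodule Rᵐᵒᵖ R :=
    { toFun := fun n =>
        { carrier := {x | ∀ i, n ≤ i → k i * x = 0}
          zero_mem' := fun i _ => mul_zero _
          add_mem' := fun {a b} ha hb i hi => by rw [mul_add, ha i hi, hb i hi, add_zero]
          smul_mem' := fun c a ha i hi => by
            rw [MulOpposite.smul_eq_mul_unop, ← mul_assoc, ha i hi, zero_mul] }
      monotone' := monotone_nat_of_le_succ fun n x hx i hi => hx i (by omega) }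
  obtain ⟨n, hn⟩ := monotone_stabilizes_iff_noetherian.mpr
    (inferInstance : IsNoetherian Rᵐᵒᵖ R) A
  obtain ⟨e, he, he'⟩ := hE n
  have : e ∈ A (n + 1) := fun i hi => he' i hi
  rw [← hn (n + 1) (Nat.le_succ n)] at this
  exact hk n (he ▸ this n le_rfl)

lemma exists_compl {R : Type*} [Ring R] [IsNoetherian Rᵐᵒᵖ R] (hinj : IsLeftAleph0Injective R)
    (L : Submodule R R) : ∃ K : Submodule R R, K.FG ∧ Disjoint L K ∧
      ∀ x, x ≠ 0 → ¬ Disjoint (L ⊔ K) (Submodule.span R {x}) := by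
  by_contra! hcon
  choose! x hx0 hx using hcon
  let F : ℕ → {K : Submodule R R // K.FG ∧ Disjoint L K} := fun n =>
    Nat.rec ⟨⊥, Submodule.fg_bot, disjoint_bot_right⟩
      (fun _ K => ⟨K.1 ⊔ Submodule.span R {x K.1},
        K.2.1.sup (Submodule.fg_span (Set.finite_singleton _)),
        K.2.2.disjoint_sup_right_of_disjoint_sup_left (hx K.1 K.2.1 K.2.2)⟩) n
  have hF : ∀ n, (F (n + 1)).1 = (F n).1 ⊔ Submodule.span R {x (F n).1} := fun n => rfl
  have hmono : Monotone fun n => (F n).1 := monotone_nat_of_le_succ fun n => by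
    rw [hF]; exact le_sup_left
  refine no_seq hinj (fun n => x (F n).1) (fun n => hx0 _ (F n).2.1 (F n).2.2)
    (fun n => (F n).1) (fun i n hin => hmono (Nat.succ_le_of_lt hin) ?_) (fun n =>
      (hx _ (F n).2.1 (F n).2.2).mono_left le_sup_right)
  show _ ∈ (F (i + 1)).1
  rw [hF]
  exact Submodule.mem_sup_right (Submodule.mem_span_singleton_self _)

lemma regular_mod {R : Type*} [Ring R] [IsNoetherian Rᵐᵒᵖ R] (hinj : IsLeftAleph0Injective R)
    (a : R) : ∃ b, ∀ x : R, x ≠ 0 → ∃ r, r * x ≠ 0 ∧ r * x * (a - a * b * a) = 0 := by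
  let μ : R →ₗ[R] R := LinearMap.toSpanSingleton R R a
  have hμ : ∀ x, μ x = x * a := fun x => rfl
  obtain ⟨K, hfg, hLK, hess⟩ := exists_compl hinj (LinearMap.ker μ)
  obtain ⟨b, hb⟩ := ext_of_inj hinj (μ ∘ₗ K.subtype) K.subtype (by
      rw [← LinearMap.ker_eq_bot, LinearMap.ker_eq_bot']
      intro m hm
      exact Subtype.ext (Submodule.disjoint_def.mp hLK _ (LinearMap.mem_ker.mpr hm) m.2)) (by
      have : (LinearMap.range (μ ∘ₗ K.subtype)).FG := by
        rw [LinearMap.range_comp, Submodule.range_subtype]; exact hfg.map μ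
      obtain ⟨s, hs⟩ := this
      exact ⟨s, s.countable_toSet, hs⟩)
  refine ⟨b, fun x hx => ?_⟩
  have h := hess x hx
  rw [Submodule.disjoint_def] at h
  push Not at h
  obtain ⟨y, hy, hyx, hy0⟩ := h
  obtain ⟨r, rfl⟩ := Submodule.mem_span_singleton.mp hyx
  obtain ⟨u, hu, v, hv, huv⟩ := Submodule.mem_sup.mp hy
  refine ⟨r, hy0, ?_⟩
  have hu' : u * a = 0 := hu
  have hv' : v * a * b = v := hb ⟨v, hv⟩
  rw [smul_eq_mul] at huv
  rw [← huv]
  calc (u + v) * (a - a * b * a)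
      = u * a - u * a * b * a + (v * a - v * a * b * a) := by noncomm_ring
    _ = 0 := by rw [hu', hv']; simp

/-- If `R` is right noetherian (ACC on right ideals) and left ℵ₀-injective, then
`R` is right artinian (DCC on right ideals). -/
theorem rightArtinian_of_rightNoetherian_leftAleph0Injective (R : Type*) [Ring R]
    [IsNoetherian Rᵐᵒᵖ R] (hinj : IsLeftAleph0Injective R) :
    IsArtinian Rᵐᵒᵖ R := by
  let E : R ≃ₗ[Rᵐᵒᵖ] Rᵐᵒᵖ :=
    { MulOpposite.opAddEquiv with
      map_smul' := fun c x => rfl }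
  have : IsNoetherianRing Rᵐᵒᵖ := isNoetherian_of_linearEquiv E
  have : IsArtinianRing Rᵐᵒᵖ := by
    apply artinian_of_regular_mod_sing
    intro a
    obtain ⟨b, hb⟩ := regular_mod hinj a.unop
    refine ⟨MulOpposite.op b, ?_⟩
    rw [mem_singZ]
    intro x hx
    obtain ⟨r, h1, h2⟩ := hb x.unop (by simpa using hx)
    refine ⟨MulOpposite.op r, ?_, ?_⟩
    · intro h; apply h1; simpa using congrArg MulOpposite.unop h
    · apply MulOpposite.unop_injective
      simpa [mul_assoc] using h2
  exact E.symm.isArtinian_iff.mp this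
end

section
/- If R is a right noetherian and left ℵ₀-injective ring, then R is quasi-Frobenius; that is, R is left and right artinian and R is injective both as a left R-module over itself and as a right R-module over itself. -/
/-- A ring `R` is *quasi-Frobenius* if it is left and right artinian and
injective as a left and as a right module over itself. -/
def IsQuasiFrobenius (R : Type*) [Ring R] : Prop :=
  IsArtinian R R ∧ IsArtinian Rᵐᵒᵖ R ∧ Module.Injective R R ∧ Module.Injective Rᵐᵒᵖ R


namespace QFAux

variable {R : Type*} [Ring R]

/-- `l(z)` is an essential left ideal. -/
def LEss (z : R) : Prop := ∀ x : R, x ≠ 0 → ∃ r : R, r * x ≠ 0 ∧ r * x * z = 0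

lemma factor (hinj : IsLeftAleph0Injective R) {N : Type*} [AddCommGroup N] [Module R N]
    (hN : ∃ S : Set N, S.Countable ∧ Submodule.span R S = ⊤)
    (g h : N →ₗ[R] R) (hgh : ∀ n, g n = 0 → h n = 0) :
    ∃ d : R, ∀ n, h n = g n * d := by
  obtain ⟨S, hS, hS'⟩ := hN
  have hle : LinearMap.ker g ≤ LinearMap.ker h := fun n hn => hgh n hn
  obtain ⟨e, he⟩ := hinj (LinearMap.range g)
    ⟨g '' S, hS.image _, by rw [Submodule.span_image, hS', Submodule.map_top]⟩
    (((LinearMap.ker g).liftQ h hle) ∘ₗ g.quotKerEquivRange.symm.toLinearMap)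
  refine ⟨e 1, fun n => ?_⟩
  have h1 := he (⟨g n, n, rfl⟩)
  have h2 : g.quotKerEquivRange.symm ⟨g n, n, rfl⟩ = (LinearMap.ker g).mkQ n := by
    rw [LinearEquiv.symm_apply_eq]
    rfl
  simp only [LinearMap.comp_apply, LinearEquiv.coe_coe] at h1
  rw [h2] at h1
  have h3 : e (g n) = g n * e 1 := by
    rw [← smul_eq_mul, ← map_smul, smul_eq_mul, mul_one]
  rw [← h3, h1]
  simp

lemma countable_of_fg {N : Type*} [AddCommGroup N] [Module R N] [Module.Finite R N] :
    ∃ S : Set N, S.Countable ∧ Submodule.span R S = ⊤ := by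
  obtain ⟨s, hs⟩ := (Module.Finite.fg_top : (⊤ : Submodule R N).FG)
  exact ⟨s, s.countable_toSet, hs⟩

lemma factor_fg (hinj : IsLeftAleph0Injective R) (F : Submodule R R) (hF : F.FG) (b x : R)
    (h : ∀ y ∈ F, y * b = 0 → y * x = 0) : ∃ d, ∀ y ∈ F, y * x = y * b * d := by
  have : Module.Finite R F := Module.Finite.iff_fg.mpr hF
  obtain ⟨d, hd⟩ := factor hinj (N := F) countable_of_fg
    ((LinearMap.toSpanSingleton R R b) ∘ₗ F.subtype)
    ((LinearMap.toSpanSingleton R R x) ∘ₗ F.subtype) (by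
      rintro ⟨y, hy⟩ h0
      simpa using h y hy (by simpa using h0))
  exact ⟨d, fun y hy => by simpa using hd ⟨y, hy⟩⟩

lemma pinj (hinj : IsLeftAleph0Injective R) (a x : R) (h : ∀ y : R, y * a = 0 → y * x = 0) :
    ∃ d, x = a * d := by
  obtain ⟨d, hd⟩ := factor_fg hinj ⊤ (Module.Finite.fg_top) a x (fun y _ => h y)
  exact ⟨d, by simpa using hd 1 trivial⟩

/-- right annihilator as right ideal -/
def rAnn (X : Set R) : Submodule Rᵐᵒᵖ R where
  carrier := {t | ∀ x ∈ X, x * t = 0}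
  add_mem' := by
    intro a b ha hb x hx
    rw [mul_add, ha x hx, hb x hx, add_zero]
  zero_mem' := by intro x _; simp
  smul_mem' := by
    intro c t ht x hx
    rw [MulOpposite.smul_eq_mul_unop, ← mul_assoc, ht x hx, zero_mul]

lemma mem_rAnn {X : Set R} {t : R} : t ∈ rAnn X ↔ ∀ x ∈ X, x * t = 0 := Iff.rfl

/-- left annihilator as left ideal -/
def lAnn (X : Set R) : Submodule R R where
  carrier := {t | ∀ x ∈ X, t * x = 0}
  add_mem' := by
    intro a b ha hb x hx
    rw [add_mul, ha x hx, hb x hx, add_zero]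
  zero_mem' := by intro x _; simp
  smul_mem' := by
    intro c t ht x hx
    rw [smul_eq_mul, mul_assoc, ht x hx, mul_zero]

lemma mem_lAnn {X : Set R} {t : R} : t ∈ lAnn X ↔ ∀ x ∈ X, t * x = 0 := Iff.rfl

lemma no_indep [IsNoetherian Rᵐᵒᵖ R] (hinj : IsLeftAleph0Injective R)
    (K : ℕ → Submodule R R) (hK : Monotone K) (k : ℕ → R) (hk : ∀ n, k n ∈ K (n + 1))
    (hk0 : ∀ n, k n ≠ 0) (hd : ∀ n r, r * k n ∈ K n → r * k n = 0) : False := by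
  have indep : ∀ (c : ℕ → R) (n : ℕ), ∑ i ∈ Finset.range n, c i * k i = 0 →
      ∀ i < n, c i * k i = 0 := by
    intro c n
    induction n with
    | zero => intro _ i hi; omega
    | succ n ih =>
      intro hs i hi
      rw [Finset.sum_range_succ] at hs
      have hmem : ∑ i ∈ Finset.range n, c i * k i ∈ K n := by
        refine Submodule.sum_mem _ fun i hi => ?_
        have hin : i + 1 ≤ n := Finset.mem_range.mp hi
        exact (K n).smul_mem (c i) (hK hin (hk i))
      have h0 : c n * k n = 0 := by
        apply hd
        rw [eq_neg_of_add_eq_zero_right hs]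
        exact Submodule.neg_mem _ hmem
      rw [h0, add_zero] at hs
      rcases Nat.lt_succ_iff_lt_or_eq.mp hi with h | h
      · exact ih hs i h
      · rw [h]; exact h0
  have hmono : Monotone (fun n => rAnn (R := R) {x | ∃ i, n ≤ i ∧ x = k i}) := by
    intro m n hmn t ht x hx
    obtain ⟨i, hi, rfl⟩ := hx
    exact ht _ ⟨i, hmn.trans hi, rfl⟩
  obtain ⟨n, hn⟩ := monotone_stabilizes_iff_noetherian.mpr ‹IsNoetherian Rᵐᵒᵖ R›
    ⟨_, hmono⟩
  have hn1 := hn (n + 1) (Nat.le_succ n)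
  simp only [OrderHom.coe_mk] at hn1
  obtain ⟨d, hd⟩ := factor hinj (N := ℕ →₀ R)
    ⟨Set.range fun i => Finsupp.single i (1 : R), Set.countable_range _, by
      have := Finsupp.supported_eq_span_single R (Set.univ : Set ℕ)
      rwa [Finsupp.supported_univ, Set.image_univ, eq_comm] at this⟩
    (Finsupp.linearCombination R k)
    (Finsupp.linearCombination R fun i => if i = n then k i else 0) (by
      intro c hc
      rw [Finsupp.linearCombination_apply] at hc ⊢
      obtain ⟨m, hm⟩ : ∃ m, c.support ⊆ Finset.range m := by
        obtain ⟨m, hm⟩ := c.support.exists_nat_subset_range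
        exact ⟨m, hm⟩
      rw [Finsupp.sum_of_support_subset _ hm _ (by simp)] at hc ⊢
      refine Finset.sum_eq_zero fun i hi => ?_
      have := indep c m hc i (Finset.mem_range.mp hi)
      split_ifs
      · exact this
      · simp)
  have hdi : ∀ i, (if i = n then k i else 0) = k i * d := by
    intro i
    simpa using hd (Finsupp.single i 1)
  have hdm : d ∈ rAnn (R := R) {x | ∃ i, n + 1 ≤ i ∧ x = k i} := by
    rintro x ⟨i, hi, rfl⟩
    rw [← hdi, if_neg (by omega)]
  rw [← hn1] at hdm
  have h1 := hdm (k n) ⟨n, le_rfl, rfl⟩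
  rw [← hdi, if_pos rfl] at h1
  exact hk0 n h1

lemma exists_ess [IsNoetherian Rᵐᵒᵖ R] (hinj : IsLeftAleph0Injective R) (L : Submodule R R) :
    ∃ K : Submodule R R, K.FG ∧ Disjoint K L ∧ ∀ x : R, x ≠ 0 → ∃ r, r * x ≠ 0 ∧ r * x ∈ K ⊔ L := by
  by_contra hcon
  push Not at hcon
  choose! nxt hn0 hnd using hcon
  have key : ∀ K : Submodule R R, K.FG ∧ Disjoint K L →
      (K ⊔ Submodule.span R {nxt K}).FG ∧ Disjoint (K ⊔ Submodule.span R {nxt K}) L := by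
    rintro K ⟨hK, hKL⟩
    refine ⟨hK.sup (Submodule.fg_span_singleton _), ?_⟩
    rw [sup_comm]
    apply hKL.disjoint_sup_left_of_disjoint_sup_right
    rw [Submodule.disjoint_def]
    intro x hx hx'
    obtain ⟨r, rfl⟩ := Submodule.mem_span_singleton.mp hx
    by_contra hne
    exact hnd K hK hKL r hne hx'
  let s : ℕ → Submodule R R := fun n =>
    Nat.rec ⊥ (fun _ K => K ⊔ Submodule.span R {nxt K}) n
  have hs : ∀ n, s (n + 1) = s n ⊔ Submodule.span R {nxt (s n)} := fun n => rfl
  have hsP : ∀ n, (s n).FG ∧ Disjoint (s n) L := by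
    intro n
    induction n with
    | zero => exact ⟨Submodule.fg_bot, disjoint_bot_left⟩
    | succ n ih => rw [hs]; exact key _ ih
  refine no_indep hinj s (monotone_nat_of_le_succ fun n => by rw [hs]; exact le_sup_left)
    (fun n => nxt (s n)) (fun n => ?_) (fun n => hn0 _ (hsP n).1 (hsP n).2) (fun n r hr => ?_)
  · rw [hs]; exact Submodule.mem_sup_right (Submodule.mem_span_singleton_self _)
  · by_contra hne
    exact hnd _ (hsP n).1 (hsP n).2 r hne (Submodule.mem_sup_left hr)

lemma regular_mod [IsNoetherian Rᵐᵒᵖ R] (hinj : IsLeftAleph0Injective R) (a : R) :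
    ∃ b, LEss (a - a * b * a) := by
  obtain ⟨K, hK, hd, he⟩ := exists_ess hinj (lAnn {a})
  obtain ⟨b, hb⟩ := factor_fg hinj K hK a 1 (by
    intro y hy hya
    rw [mul_one]
    exact (Submodule.disjoint_def.mp hd) y hy (by intro x hx; rw [hx]; exact hya))
  refine ⟨b, fun x hx => ?_⟩
  obtain ⟨r, hr, hm⟩ := he x hx
  refine ⟨r, hr, ?_⟩
  obtain ⟨y, hy, z, hz, hyz⟩ := Submodule.mem_sup.mp hm
  have hz' : z * a = 0 := hz a rfl
  have h1 := hb y hy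
  rw [mul_one] at h1
  have h2 : y * a * b * a = y * a := by rw [← h1]
  rw [← hyz]
  simp only [mul_sub, add_mul, ← mul_assoc, hz', zero_mul, h2]
  simp

lemma unit_swap {x y : R} (h : IsUnit (1 - x * y)) : IsUnit (1 - y * x) := by
  obtain ⟨u, hu⟩ := h
  have h1 : (1 - x * y) * (↑u⁻¹ : R) = 1 := by rw [← hu]; simp
  have h2 : (↑u⁻¹ : R) * (1 - x * y) = 1 := by rw [← hu]; simp
  refine isUnit_iff_exists.mpr ⟨1 + y * ↑u⁻¹ * x, ?_, ?_⟩
  · have : (1 - y * x) * (1 + y * ↑u⁻¹ * x) =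
      1 - y * x + y * ((1 - x * y) * ↑u⁻¹) * x := by noncomm_ring
    rw [this, h1]; noncomm_ring
  · have : (1 + y * ↑u⁻¹ * x) * (1 - y * x) =
      1 - y * x + y * (↑u⁻¹ * (1 - x * y)) * x := by noncomm_ring
    rw [this, h2]; noncomm_ring

lemma mem_jac {x : R} : x ∈ Ring.jacobson R ↔ ∀ y, IsUnit (1 - y * x) := by
  rw [← Ideal.jacobson_bot, Ideal.mem_jacobson_iff]
  simp only [Ideal.mem_bot]
  constructor
  · intro h y
    obtain ⟨z, hz⟩ := h (-y)
    have hz1 : z * (1 - y * x) = 1 := by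
      rw [← sub_eq_zero, ← hz]; noncomm_ring
    obtain ⟨w, hw⟩ := h (z * y)
    have hzz : z = 1 + z * y * x := by
      rw [← hz1]; noncomm_ring
    have hw1 : w * z = 1 := by
      rw [hzz, ← sub_eq_zero, ← hw]; noncomm_ring
    have hwe : w = 1 - y * x := by
      calc w = w * (z * (1 - y * x)) := by rw [hz1, mul_one]
        _ = 1 - y * x := by rw [← mul_assoc, hw1, one_mul]
    exact isUnit_iff_exists.mpr ⟨z, by rw [← hwe, hw1], hz1⟩
  · intro h y
    obtain ⟨z, -, hz⟩ := isUnit_iff_exists.mp (h (-y))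
    refine ⟨z, ?_⟩
    rw [← sub_eq_zero] at hz
    rw [← hz]; noncomm_ring

lemma mem_jac' {x : R} : x ∈ Ring.jacobson R ↔ ∀ y, IsUnit (1 - x * y) :=
  mem_jac.trans ⟨fun h y => unit_swap (h y), fun h y => unit_swap (h y)⟩

lemma jac_mul_left {x : R} (hx : x ∈ Ring.jacobson R) (y : R) : y * x ∈ Ring.jacobson R :=
  (Ring.jacobson R).mul_mem_left y hx

lemma jac_mul_right {x : R} (hx : x ∈ Ring.jacobson R) (y : R) : x * y ∈ Ring.jacobson R :=
  mem_jac'.mpr fun z => by rw [mul_assoc]; exact mem_jac'.mp hx _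

lemma LEss.mem_jac (hinj : IsLeftAleph0Injective R) {z : R} (hz : LEss z) :
    z ∈ Ring.jacobson R := by
  have key : ∀ y, ∃ w, (1 - z * y) * w = 1 := by
    intro y
    obtain ⟨w, hw⟩ := pinj hinj (1 - z * y) 1 (by
      intro v hv
      rw [mul_one]
      by_contra hne
      obtain ⟨r, hr, hr'⟩ := hz v hne
      apply hr
      have h1 : v = v * z * y := by
        rw [← sub_eq_zero, ← hv]; noncomm_ring
      rw [h1, ← mul_assoc, ← mul_assoc, hr', zero_mul])
    exact ⟨w, hw.symm⟩
  refine mem_jac'.mpr fun y => ?_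
  obtain ⟨w, hw⟩ := key y
  obtain ⟨u, hu⟩ := key (-(y * w))
  have hww : w = 1 - z * -(y * w) := by rw [← hw]; noncomm_ring
  rw [← hww] at hu
  have hue : u = 1 - z * y := by
    calc u = ((1 - z * y) * w) * u := by rw [hw, one_mul]
      _ = 1 - z * y := by rw [mul_assoc, hu, mul_one]
  exact isUnit_iff_exists.mpr ⟨w, hw, by rw [← hue, hu]⟩

lemma less_of_jac [IsNoetherian Rᵐᵒᵖ R] (hinj : IsLeftAleph0Injective R) {z : R}
    (hz : z ∈ Ring.jacobson R) : LEss z := by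
  obtain ⟨b, hb⟩ := regular_mod hinj z
  obtain ⟨u, hu, -⟩ := isUnit_iff_exists.mp (mem_jac.mp hz b)
  intro x hx
  obtain ⟨r, hr, hr'⟩ := hb x hx
  refine ⟨r, hr, ?_⟩
  calc r * x * z = r * x * z * ((1 - b * z) * u) := by rw [hu, mul_one]
    _ = (r * x * (z - z * b * z)) * u := by noncomm_ring
    _ = 0 := by rw [hr', zero_mul]

lemma regular_mod_jac [IsNoetherian Rᵐᵒᵖ R] (hinj : IsLeftAleph0Injective R) (a : R) :
    ∃ b, a - a * b * a ∈ Ring.jacobson R := by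
  obtain ⟨b, hb⟩ := regular_mod hinj a
  exact ⟨b, hb.mem_jac hinj⟩


/-- right ideal from the Jacobson radical condition `e * x - x ∈ J` -/
def fixR (e : R) : Submodule Rᵐᵒᵖ R where
  carrier := {x | e * x - x ∈ Ring.jacobson R}
  add_mem' := by
    intro a b ha hb
    have : e * (a + b) - (a + b) = (e * a - a) + (e * b - b) := by noncomm_ring
    simp only [Set.mem_ofPred_eq] at *
    rw [this]; exact add_mem ha hb
  zero_mem' := by simp
  smul_mem' := by
    intro c x hx
    simp only [Set.mem_ofPred_eq, MulOpposite.smul_eq_mul_unop] at *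
    rw [← mul_assoc, ← sub_mul]
    exact jac_mul_right hx _

lemma mem_fixR {e x : R} : x ∈ fixR e ↔ e * x - x ∈ Ring.jacobson R := Iff.rfl

lemma mkJ {x : R} : x ∈ Ring.jacobson R ↔ Ideal.Quotient.mk (Ring.jacobson R) x = 0 :=
  Ideal.Quotient.eq_zero_iff_mem.symm

lemma lemE [IsNoetherian Rᵐᵒᵖ R] (hinj : IsLeftAleph0Injective R) (Q : Submodule R R) :
    ∃ e ∈ Q, ∀ q ∈ Q, q * e - q ∈ Ring.jacobson R := by
  obtain ⟨M, ⟨e, heQ, hee, rfl⟩, hmax⟩ := set_has_maximal_iff_noetherian.mpr ‹IsNoetherian Rᵐᵒᵖ R›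
    {T | ∃ e ∈ Q, e * e - e ∈ Ring.jacobson R ∧ T = fixR e}
    ⟨_, 0, Q.zero_mem, by simp, rfl⟩
  refine ⟨e, heQ, ?_⟩
  by_contra hcon
  push Not at hcon
  obtain ⟨q, hq, hqe⟩ := hcon
  let p := Ideal.Quotient.mk (Ring.jacobson R)
  have hE : p e * p e = p e := by
    rw [mkJ, map_sub, map_mul, sub_eq_zero] at hee; exact hee
  obtain ⟨b, hb⟩ := regular_mod_jac hinj (q - q * e)
  have hqQ : q - q * e ∈ Q := Q.sub_mem hq (Q.smul_mem q heQ)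
  set q' := q - q * e with hq'
  have hB : p q' * p b * p q' = p q' := by
    rw [mkJ, map_sub, map_mul, map_mul, sub_eq_zero] at hb; exact hb.symm
  have hqE : p q' * p e = 0 := by
    rw [hq', map_sub, map_mul, sub_mul, mul_assoc, hE, sub_self]
  have hq0 : p q' ≠ 0 := by
    intro h
    apply hqe
    rw [mkJ, ← neg_sub, map_neg, neg_eq_zero]
    exact h
  set g := b * q' - e * (b * q') with hg
  have hgQ : g ∈ Q := Q.sub_mem (Q.smul_mem b hqQ) (Q.smul_mem e (Q.smul_mem b hqQ))
  have hpg : p g = p b * p q' - p e * (p b * p q') := by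
    rw [hg]; simp only [map_sub, map_mul]
  have hEg : p e * p g = 0 := by
    rw [hpg, mul_sub, ← mul_assoc (p e) (p e), hE, sub_self]
  have hgx : ∀ x, p q' * x = 0 → p g * x = 0 := by
    intro x hx
    rw [hpg, sub_mul, mul_assoc, mul_assoc, mul_assoc, hx]; simp
  have hqg : p q' * p g = p q' := by
    rw [hpg, mul_sub, ← mul_assoc (p q') (p e), hqE, zero_mul, sub_zero, ← mul_assoc, hB]
  have hgg : p g * p g = p g := by
    have : p g * (p g - 1) = 0 := hgx _ (by rw [mul_sub, hqg, mul_one, sub_self])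
    rwa [mul_sub, mul_one, sub_eq_zero] at this
  have hgE : p g * p e = 0 := hgx _ hqE
  have hlt : fixR e ≤ fixR (e + g) := by
    intro x hx
    rw [mem_fixR, mkJ, map_sub, map_mul, sub_eq_zero] at hx ⊢
    rw [map_add, add_mul]
    have : p g * p x = 0 := by
      change p e * p x = p x at hx
      rw [← hx, ← mul_assoc, hgE, zero_mul]
    change p e * p x + p g * p x = p x
    rw [this, add_zero]; exact hx
  have hnl := hmax (fixR (e + g)) ⟨e + g, Q.add_mem heQ hgQ, by
    rw [mkJ, map_sub, map_mul, map_add, sub_eq_zero]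
    change (p e + p g) * (p e + p g) = p e + p g
    rw [add_mul, mul_add, mul_add, hE, hEg, hgE, hgg]; simp, rfl⟩
  have heq : fixR (e + g) ≤ fixR e := by
    by_contra h
    exact hnl (lt_of_le_not_ge hlt h)
  have hgm : g ∈ fixR (e + g) := by
    rw [mem_fixR, mkJ, map_sub, map_mul, map_add, sub_eq_zero]
    change (p e + p g) * p g = p g
    rw [add_mul, hEg, hgg, zero_add]
  have h1 := heq hgm
  rw [mem_fixR, mkJ, map_sub, map_mul, sub_eq_zero] at h1
  change p e * p g = p g at h1
  rw [hEg] at h1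
  apply hq0
  rw [← hqg, ← h1, mul_zero]

lemma semisimple [IsNoetherian Rᵐᵒᵖ R] (hinj : IsLeftAleph0Injective R) :
    IsSemisimpleRing (R ⧸ Ring.jacobson R) := by
  have : ComplementedLattice (Submodule (R ⧸ Ring.jacobson R) (R ⧸ Ring.jacobson R)) := by
    refine ⟨fun I => ?_⟩
    obtain ⟨e, he, heq⟩ := lemE hinj (Ideal.comap (Ideal.Quotient.mk (Ring.jacobson R)) I)
    set E := Ideal.Quotient.mk (Ring.jacobson R) e with hE
    have he' : E ∈ I := he
    have hid : ∀ x ∈ I, x * E = x := by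
      intro x hx
      obtain ⟨y, rfl⟩ := Ideal.Quotient.mk_surjective x
      have := heq y hx
      rwa [mkJ, map_sub, map_mul, sub_eq_zero] at this
    refine ⟨lAnn {E}, ?_, ?_⟩
    · rw [Submodule.disjoint_def]
      intro x hx hx'
      rw [← hid x hx]; exact hx' E rfl
    · rw [codisjoint_iff, eq_top_iff]
      intro x _
      refine Submodule.mem_sup.mpr ⟨x * E, I.smul_mem x he', x - x * E, ?_, by abel⟩
      intro y hy
      rw [hy, sub_mul, mul_assoc, hid E he', sub_self]
  exact { toComplementedLattice := this }

lemma ess_vec [IsNoetherian Rᵐᵒᵖ R] (hinj : IsLeftAleph0Injective R) {x : R} (hx : x ≠ 0) :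
    ∃ r, r * x ≠ 0 ∧ ∀ z ∈ Ring.jacobson R, r * x * z = 0 := by
  let T : Submodule Rᵐᵒᵖ R :=
    { carrier := Ring.jacobson R
      add_mem' := fun ha hb => add_mem ha hb
      zero_mem' := zero_mem _
      smul_mem' := fun c y hy => jac_mul_right hy _ }
  have main : ∀ U : Submodule Rᵐᵒᵖ R, U ≤ T → ∀ x : R, x ≠ 0 →
      ∃ r, r * x ≠ 0 ∧ ∀ z ∈ U, r * x * z = 0 := by
    intro U
    induction U, (IsNoetherian.noetherian U) using Submodule.fg_induction with
    | singleton a =>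
      intro ha x hx
      obtain ⟨r, hr, hr'⟩ := less_of_jac hinj
        (show a ∈ Ring.jacobson R from ha (Submodule.mem_span_singleton_self a)) x hx
      refine ⟨r, hr, fun z hz => ?_⟩
      obtain ⟨c, rfl⟩ := Submodule.mem_span_singleton.mp hz
      rw [MulOpposite.smul_eq_mul_unop, ← mul_assoc, hr', zero_mul]
    | sup U V hU hV ihU ihV =>
      intro h x hx
      obtain ⟨r, hr, hr'⟩ := ihU (le_sup_left.trans h) x hx
      obtain ⟨s, hs, hs'⟩ := ihV (le_sup_right.trans h) _ hr
      refine ⟨s * r, by rwa [mul_assoc], fun z hz => ?_⟩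
      obtain ⟨u, hu, v, hv, rfl⟩ := Submodule.mem_sup.mp hz
      have h1 := hr' u hu
      have h2 := hs' v hv
      rw [mul_add, mul_assoc s r x, h2, mul_assoc s, h1]; simp
  exact main T le_rfl x hx

lemma ess_vec2 [IsNoetherian Rᵐᵒᵖ R] (hinj : IsLeftAleph0Injective R) (U : Submodule Rᵐᵒᵖ R) :
    ∀ x : R, (∃ u ∈ U, x * u ≠ 0) →
      ∃ r, (∃ u ∈ U, r * x * u ≠ 0) ∧ ∀ u ∈ U, ∀ z ∈ Ring.jacobson R, r * x * u * z = 0 := by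
  induction U, (IsNoetherian.noetherian U) using Submodule.fg_induction with
  | singleton a =>
    rintro x ⟨u, hu, hxu⟩
    have hxa : x * a ≠ 0 := by
      intro h
      obtain ⟨c, rfl⟩ := Submodule.mem_span_singleton.mp hu
      apply hxu
      rw [MulOpposite.smul_eq_mul_unop, ← mul_assoc, h, zero_mul]
    obtain ⟨r, hr, hr'⟩ := ess_vec hinj hxa
    refine ⟨r, ⟨a, Submodule.mem_span_singleton_self a, by rwa [mul_assoc]⟩, fun u hu z hz => ?_⟩
    obtain ⟨c, rfl⟩ := Submodule.mem_span_singleton.mp hu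
    have := hr' _ (jac_mul_left hz c.unop)
    rw [MulOpposite.smul_eq_mul_unop, ← this]
    simp only [mul_assoc]
  | sup U V hU hV ihU ihV =>
    rintro x ⟨w, hw, hxw⟩
    have comb : ∀ r : R, (∀ u ∈ U, ∀ z ∈ Ring.jacobson R, r * x * u * z = 0) →
        (∀ u ∈ V, ∀ z ∈ Ring.jacobson R, r * x * u * z = 0) →
        ∀ u ∈ U ⊔ V, ∀ z ∈ Ring.jacobson R, r * x * u * z = 0 := by
      intro r h1 h2 w hw z hz
      obtain ⟨u, hu, v, hv, rfl⟩ := Submodule.mem_sup.mp hw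
      rw [mul_add, add_mul, h1 u hu z hz, h2 v hv z hz, add_zero]
    by_cases hxU : ∃ u ∈ U, x * u ≠ 0
    · obtain ⟨r, ⟨u, hu, hru⟩, hr⟩ := ihU x hxU
      by_cases hxV : ∃ v ∈ V, r * x * v ≠ 0
      · obtain ⟨s, ⟨v, hv, hsv⟩, hs⟩ := ihV _ hxV
        refine ⟨s * r, ⟨v, Submodule.mem_sup_right hv, by rwa [mul_assoc s]⟩, comb _ ?_ ?_⟩
        · intro u hu z hz
          have := hr u hu z hz
          calc s * r * x * u * z = s * (r * x * u * z) := by simp only [mul_assoc]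
            _ = 0 := by rw [this, mul_zero]
        · intro u hu z hz
          rw [mul_assoc s r x]; exact hs u hu z hz
      · push Not at hxV
        exact ⟨r, ⟨u, Submodule.mem_sup_left hu, hru⟩, comb _ hr
          fun v hv z _ => by rw [hxV v hv, zero_mul]⟩
    · push Not at hxU
      obtain ⟨r, ⟨v, hv, hrv⟩, hr⟩ := ihV x (by
        obtain ⟨u, hu, v, hv, rfl⟩ := Submodule.mem_sup.mp hw
        rw [mul_add, hxU u hu, zero_add] at hxw
        exact ⟨v, hv, hxw⟩)
      exact ⟨r, ⟨v, Submodule.mem_sup_right hv, hrv⟩, comb _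
        (fun u hu z _ => by rw [mul_assoc r, hxU u hu, mul_zero, zero_mul]) hr⟩

lemma nilp [IsNoetherian Rᵐᵒᵖ R] (hinj : IsLeftAleph0Injective R) :
    IsNilpotent (Ring.jacobson R) := by
  let L : ℕ → Submodule Rᵐᵒᵖ R := fun n =>
    { carrier := {x | ∀ u ∈ (Ring.jacobson R) ^ n, x * u = 0}
      add_mem' := fun {a b} ha hb u hu => by rw [add_mul, ha u hu, hb u hu, add_zero]
      zero_mem' := fun u _ => zero_mul u
      smul_mem' := fun c x hx u hu => by
        rw [MulOpposite.smul_eq_mul_unop, mul_assoc]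
        exact hx _ (Ideal.mul_mem_left _ _ hu) }
  have hmono : Monotone L := by
    intro m n hmn x hx u hu
    exact hx u (Ideal.pow_le_pow_right hmn hu)
  obtain ⟨n, hn⟩ := monotone_stabilizes_iff_noetherian.mpr ‹IsNoetherian Rᵐᵒᵖ R› ⟨_, hmono⟩
  have hn1 : L n = L (n + 1) := hn (n + 1) (Nat.le_succ n)
  refine ⟨n, ?_⟩
  by_contra hne
  obtain ⟨u, hu, hu0⟩ := Submodule.exists_mem_ne_zero_of_ne_bot hne
  let U : Submodule Rᵐᵒᵖ R :=
    { carrier := ((Ring.jacobson R) ^ n : Ideal R)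
      add_mem' := fun ha hb => add_mem ha hb
      zero_mem' := zero_mem _
      smul_mem' := fun c y hy => Ideal.mul_mem_right _ _ hy }
  obtain ⟨r, ⟨v, hv, hrv⟩, hr⟩ := ess_vec2 hinj U 1 ⟨u, hu, by rwa [one_mul]⟩
  have hrL : r ∈ L (n + 1) := by
    intro w hw
    rw [Submodule.pow_succ] at hw
    refine Submodule.mul_induction_on hw (fun a ha z hz => ?_) (fun a b ha hb => ?_)
    · have := hr a ha z hz
      rw [mul_one] at this
      rw [← mul_assoc, this]
    · rw [mul_add, ha, hb, add_zero]
  rw [← hn1] at hrL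
  apply hrv
  rw [mul_one]; exact hrL v hv

lemma jac_op {x : Rᵐᵒᵖ} : x ∈ Ring.jacobson Rᵐᵒᵖ ↔ x.unop ∈ Ring.jacobson R := by
  rw [mem_jac, mem_jac']
  constructor
  · intro h y
    have := (h (MulOpposite.op y)).unop
    simpa using this
  · intro h y
    have := (h y.unop).op
    simpa using this

lemma artinian_right [IsNoetherian Rᵐᵒᵖ R] (hinj : IsLeftAleph0Injective R) :
    IsArtinian Rᵐᵒᵖ R := by
  have hss := semisimple hinj
  have hsp : IsSemiprimaryRing Rᵐᵒᵖ := by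
    constructor
    · let f : Rᵐᵒᵖ →+* (R ⧸ Ring.jacobson R)ᵐᵒᵖ := (Ideal.Quotient.mk (Ring.jacobson R)).op
      have hf : Function.Surjective f := by
        intro y
        obtain ⟨x, hx⟩ := Ideal.Quotient.mk_surjective y.unop
        exact ⟨MulOpposite.op x, by simp [f, hx]⟩
      have hk : RingHom.ker f = Ring.jacobson Rᵐᵒᵖ := by
        ext x
        rw [jac_op, RingHom.mem_ker, mkJ]
        simp [f]
      have e := RingHom.quotientKerEquivOfSurjective hf
      have h2 := e.symm.isSemisimpleRing
      exact (Ideal.quotEquivOfEq hk).isSemisimpleRing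
    · obtain ⟨n, hn⟩ := nilp hinj
      refine ⟨n, ?_⟩
      have key : ∀ m, ∀ x ∈ (Ring.jacobson Rᵐᵒᵖ) ^ m, x.unop ∈ (Ring.jacobson R) ^ m := by
        intro m
        induction m with
        | zero => intro x _; rw [Submodule.pow_zero]; simp
        | succ m ih =>
          intro x hx
          rw [Ideal.IsTwoSided.pow_succ] at hx
          rw [Submodule.pow_succ]
          refine Submodule.mul_induction_on hx (fun a ha z hz => ?_) (fun a b ha hb => ?_)
          · rw [MulOpposite.unop_mul]
            exact Ideal.mul_mem_mul (ih z hz) (jac_op.mp ha)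
          · rw [MulOpposite.unop_add]; exact add_mem ha hb
      refine eq_bot_iff.mpr ?_
      intro x hx
      have := key n x hx
      rw [hn] at this
      simpa using this
  exact IsSemiprimaryRing.isNoetherian_iff_isArtinian.mp ‹IsNoetherian Rᵐᵒᵖ R›

lemma semiprimary [IsNoetherian Rᵐᵒᵖ R] (hinj : IsLeftAleph0Injective R) :
    IsSemiprimaryRing R := ⟨semisimple hinj, nilp hinj⟩

lemma dcc [IsArtinian Rᵐᵒᵖ R] (X : Submodule R R) :
    ∃ F : Submodule R R, F.FG ∧ F ≤ X ∧ ∀ x ∈ X, ∀ t ∈ rAnn (F : Set R), x * t = 0 := by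
  obtain ⟨M, ⟨F, hF, hFX, rfl⟩, hmin⟩ := set_has_minimal_iff_artinian.mpr ‹IsArtinian Rᵐᵒᵖ R›
    {T | ∃ F : Submodule R R, F.FG ∧ F ≤ X ∧ T = rAnn (F : Set R)}
    ⟨_, ⊥, Submodule.fg_bot, bot_le, rfl⟩
  refine ⟨F, hF, hFX, fun x hx t ht => ?_⟩
  by_contra hne
  refine hmin (rAnn ((F ⊔ Submodule.span R {x} : Submodule R R) : Set R))
    ⟨_, hF.sup (Submodule.fg_span_singleton x), sup_le hFX (by simpa using hx), rfl⟩ ?_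
  refine lt_of_le_not_ge (fun u hu y hy => hu y (Submodule.mem_sup_left hy)) (fun h => hne ?_)
  exact h ht x (Submodule.mem_sup_right (Submodule.mem_span_singleton_self x))

lemma rl [IsNoetherian Rᵐᵒᵖ R] [IsArtinian Rᵐᵒᵖ R] (hinj : IsLeftAleph0Injective R)
    (T : Submodule Rᵐᵒᵖ R) : ∀ x, (∀ y ∈ lAnn (T : Set R), y * x = 0) → x ∈ T := by
  classical
  obtain ⟨s, rfl⟩ := IsNoetherian.noetherian T
  induction s using Finset.induction with
  | empty =>
    intro x hx
    have := hx 1 (by intro z hz; simp at hz; simp [hz])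
    rw [one_mul] at this
    rw [this]; exact zero_mem _
  | insert b s _ ih =>
    intro x hx
    obtain ⟨F, hF, hFX, hFa⟩ := dcc (lAnn ((Submodule.span Rᵐᵒᵖ (s : Set R) : Submodule Rᵐᵒᵖ R) : Set R))
    obtain ⟨d, hd⟩ := factor_fg hinj F hF b x (by
      intro y hy hyb
      apply hx
      intro t ht
      rw [Finset.coe_insert, Submodule.span_insert] at ht
      obtain ⟨u, hu, v, hv, rfl⟩ := Submodule.mem_sup.mp ht
      obtain ⟨c, rfl⟩ := Submodule.mem_span_singleton.mp hu
      rw [mul_add, hFX hy v hv, MulOpposite.smul_eq_mul_unop, ← mul_assoc, hyb]; simp)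
    have hm : x - b * d ∈ Submodule.span Rᵐᵒᵖ (s : Set R) := by
      apply ih
      intro y hy
      apply hFa y hy
      intro z hz
      rw [mul_sub, hd z hz, mul_assoc, sub_self]
    rw [Finset.coe_insert, Submodule.span_insert]
    refine Submodule.mem_sup.mpr ⟨b * d, ?_, _, hm, by abel⟩
    exact Submodule.mem_span_singleton.mpr ⟨MulOpposite.op d, by simp⟩

/-- membership in the left socle `r(J)` -/
def Soc (s : R) : Prop := ∀ z ∈ Ring.jacobson R, z * s = 0

lemma Soc.mul_right {s : R} (hs : Soc s) (t : R) : Soc (s * t) := fun z hz => by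
  rw [← mul_assoc, hs z hz, zero_mul]

lemma Soc.mul_left {s : R} (hs : Soc s) (t : R) : Soc (t * s) := fun z hz => by
  rw [← mul_assoc, hs _ (jac_mul_right hz t)]

lemma Soc.mul_jac [IsNoetherian Rᵐᵒᵖ R] (hinj : IsLeftAleph0Injective R) {s z : R} (hs : Soc s)
    (hz : z ∈ Ring.jacobson R) : s * z = 0 := by
  obtain ⟨e, he, heq⟩ := lemE hinj (lAnn {s * z})
  have he0 : e * (s * z) = 0 := he _ rfl
  have hu : (1 - e) * s = 0 := by
    by_contra hne
    obtain ⟨x, hx, hx'⟩ := less_of_jac hinj hz _ hne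
    apply hx
    have hQ : x * (1 - e) ∈ lAnn {s * z} := by
      intro y hy
      rw [hy, ← hx']; simp only [mul_assoc]
    have h1 := heq _ hQ
    have h2 := jac_mul_left (heq e he) x
    have h3 : x * (1 - e) ∈ Ring.jacobson R := by
      have : x * (1 - e) = -(x * (1 - e) * e - x * (1 - e)) - x * (e * e - e) := by noncomm_ring
      rw [this]
      exact sub_mem (neg_mem h1) h2
    rw [← mul_assoc]; exact hs _ h3
  have : s = e * s := by
    rw [← sub_eq_zero, ← hu]; noncomm_ring
  rw [this, mul_assoc, he0]

lemma soc_ess [IsNoetherian Rᵐᵒᵖ R] (hinj : IsLeftAleph0Injective R) {x : R} (hx : x ≠ 0) :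
    ∃ r, r * x ≠ 0 ∧ Soc (r * x) := by
  classical
  obtain ⟨n, hn⟩ := nilp hinj
  have hex : ∃ n, ∀ u ∈ (Ring.jacobson R) ^ n, u * x = 0 := by
    refine ⟨n, fun u hu => ?_⟩
    rw [hn] at hu
    have : u = 0 := by simpa using hu
    rw [this, zero_mul]
  obtain ⟨m, hm⟩ : ∃ m, Nat.find hex = m := ⟨_, rfl⟩
  have hspec := Nat.find_spec hex
  rw [hm] at hspec
  cases m with
  | zero =>
    exfalso
    apply hx
    have := hspec 1 (by rw [Submodule.pow_zero]; simp)
    rwa [one_mul] at this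
  | succ m =>
    have hmin := Nat.find_min hex (m := m) (by omega)
    push Not at hmin
    obtain ⟨u, hu, hux⟩ := hmin
    refine ⟨u, hux, fun z hz => ?_⟩
    rw [← mul_assoc]
    apply hspec
    rw [Ideal.IsTwoSided.pow_succ]
    exact Ideal.mul_mem_mul hz hu

/-- The Jacobson radical as a right ideal -/
def Jr (R : Type*) [Ring R] : Submodule Rᵐᵒᵖ R where
  carrier := Ring.jacobson R
  add_mem' := fun ha hb => add_mem ha hb
  zero_mem' := zero_mem _
  smul_mem' := fun c y hy => jac_mul_right hy _

lemma mem_Jr {x : R} : x ∈ Jr R ↔ x ∈ Ring.jacobson R := Iff.rfl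

lemma rSoc [IsNoetherian Rᵐᵒᵖ R] [IsArtinian Rᵐᵒᵖ R] (hinj : IsLeftAleph0Injective R) {x : R}
    (hx : ∀ s, Soc s → s * x = 0) : x ∈ Ring.jacobson R := by
  let Y : Submodule R R :=
    { carrier := {x | ∀ s, Soc s → s * x = 0}
      add_mem' := fun {a b} ha hb s hs => by rw [mul_add, ha s hs, hb s hs, add_zero]
      zero_mem' := fun s _ => mul_zero s
      smul_mem' := fun c x hx s hs => by
        rw [smul_eq_mul, ← mul_assoc]; exact hx _ (hs.mul_right c) }
  obtain ⟨e, he, heq⟩ := lemE hinj Y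
  have heJ : e ∈ Jr R := by
    apply rl hinj
    intro y hy
    by_contra hne
    obtain ⟨r, hr, hrs⟩ := soc_ess hinj hne
    apply hr
    have h1 : r * (y * e) * e = 0 := he _ hrs
    have h2 : y * (e * e - e) = 0 := hy _ (heq e he)
    calc r * (y * e) = r * (y * e) * e - r * (y * (e * e - e)) := by noncomm_ring
      _ = 0 := by rw [h1, h2]; simp
  have h3 := heq x hx
  have : x = x * e - (x * e - x) := by abel
  rw [this]
  exact sub_mem (jac_mul_left heJ x) h3

/-- The duality operator `Y ↦ l(S Y)` -/
def ff (Y : Submodule Rᵐᵒᵖ R) : Submodule Rᵐᵒᵖ R where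
  carrier := {x | ∀ s, Soc s → ∀ y ∈ Y, x * s * y = 0}
  add_mem' := fun {a b} ha hb s hs y hy => by
    rw [add_mul, add_mul, ha s hs y hy, hb s hs y hy, add_zero]
  zero_mem' := fun s _ y _ => by simp
  smul_mem' := fun c x hx s hs y hy => by
    rw [MulOpposite.smul_eq_mul_unop, mul_assoc x]
    exact hx _ (hs.mul_left _) y hy

lemma mem_ff {Y : Submodule Rᵐᵒᵖ R} {x : R} :
    x ∈ ff Y ↔ ∀ s, Soc s → ∀ y ∈ Y, x * s * y = 0 := Iff.rfl

/-- two-sided ideals containing `J` -/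
def PP (Y : Submodule Rᵐᵒᵖ R) : Prop := Jr R ≤ Y ∧ ∀ r, ∀ x ∈ Y, r * x ∈ Y

lemma PP_ff (Y : Submodule Rᵐᵒᵖ R) : PP (ff Y) := by
  refine ⟨fun z hz s hs y _ => ?_, fun r x hx s hs y hy => ?_⟩
  · rw [hs z hz, zero_mul]
  · rw [mul_assoc r, mul_assoc r, hx s hs y hy, mul_zero]

lemma ff_anti {Y Y' : Submodule Rᵐᵒᵖ R} (h : Y ≤ Y') : ff Y' ≤ ff Y :=
  fun _ hx s hs y hy => hx s hs y (h hy)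

lemma ff_strict [IsNoetherian Rᵐᵒᵖ R] [IsArtinian Rᵐᵒᵖ R] (hinj : IsLeftAleph0Injective R)
    {Y Y' : Submodule Rᵐᵒᵖ R} (hY : PP Y) (h : Y < Y') : ff Y' < ff Y := by
  refine lt_of_le_not_ge (ff_anti h.le) fun hle => ?_
  apply not_le_of_gt h
  let YL : Submodule R R :=
    { carrier := Y
      add_mem' := fun ha hb => add_mem ha hb
      zero_mem' := zero_mem _
      smul_mem' := fun c x hx => hY.2 c x hx }
  obtain ⟨e, he, heq⟩ := lemE hinj YL
  intro y' hy'
  have hj : y' * e - y' ∈ Ring.jacobson R := by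
    apply rSoc hinj
    intro s hs
    have hV : s * y' ∈ Submodule.span Rᵐᵒᵖ {w : R | ∃ s y, Soc s ∧ y ∈ Y ∧ w = s * y} := by
      apply rl hinj
      intro v hv
      have : v ∈ ff Y := by
        intro s hs y hy
        rw [mul_assoc]
        exact hv _ (Submodule.subset_span ⟨s, y, hs, hy, rfl⟩)
      rw [← mul_assoc]
      exact hle this s hs y' hy'
    have hC : ∀ w ∈ Submodule.span Rᵐᵒᵖ {w : R | ∃ s y, Soc s ∧ y ∈ Y ∧ w = s * y},
        ∀ t, w * t * e = w * t := by
      intro w hw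
      induction hw using Submodule.span_induction with
      | mem w hw =>
        obtain ⟨s, y, hs, hy, rfl⟩ := hw
        intro t
        have h1 : y * t ∈ YL := Y.smul_mem (MulOpposite.op t) hy
        have h2 := hs.mul_jac hinj (heq _ h1)
        rw [← sub_eq_zero, ← h2]; noncomm_ring
      | zero => simp
      | add a b _ _ ha hb => intro t; rw [add_mul, add_mul, ha, hb]
      | smul c a _ ha =>
        intro t
        rw [MulOpposite.smul_eq_mul_unop, mul_assoc a]; exact ha _
    have := hC _ hV 1
    rw [mul_one] at this
    rw [mul_sub, ← mul_assoc, this, sub_self]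
  have h1 : y' * e ∈ Y := hY.2 y' e he
  have : y' = y' * e - (y' * e - y') := by abel
  rw [this]
  exact sub_mem h1 (hY.1 hj)

lemma kasch [IsNoetherian Rᵐᵒᵖ R] [IsArtinian Rᵐᵒᵖ R] (hinj : IsLeftAleph0Injective R) {x : R}
    (hx : ∀ s, Soc s → x * s = 0) : x ∈ Ring.jacobson R := by
  by_contra hne
  have hlt : Jr R < ff ⊤ := by
    refine lt_of_le_not_ge (PP_ff _).1 fun h => hne ?_
    exact h (fun s hs y _ => by rw [hx s hs, zero_mul])
  let Y : ℕ → Submodule Rᵐᵒᵖ R := fun n => (fun Z => ff (ff Z))^[n] (Jr R)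
  have hYs : ∀ n, Y (n + 1) = ff (ff (Y n)) := fun n => Function.iterate_succ_apply' _ _ _
  have hP : ∀ n, PP (Y n) := by
    intro n
    cases n with
    | zero => exact ⟨le_rfl, fun r x hx => jac_mul_left hx r⟩
    | succ n => rw [hYs]; exact PP_ff _
  have hmono : ∀ n, Y n < Y (n + 1) := by
    intro n
    induction n with
    | zero =>
      rw [hYs]
      exact lt_of_lt_of_le hlt (ff_anti le_top)
    | succ n ih =>
      rw [hYs n, hYs (n + 1)]
      exact ff_strict hinj (PP_ff _) (ff_strict hinj (hP n) ih)
  exact not_strictMono_of_wellFoundedGT Y (strictMono_nat_of_lt_succ hmono)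

lemma lr [IsNoetherian Rᵐᵒᵖ R] [IsArtinian Rᵐᵒᵖ R] (hinj : IsLeftAleph0Injective R)
    (I : Submodule R R) (hI : I.FG) (x : R) (hx : ∀ t ∈ rAnn (I : Set R), x * t = 0) : x ∈ I := by
  by_contra hne
  obtain ⟨e, he, heq⟩ := lemE hinj (I.comap (LinearMap.toSpanSingleton R R x))
  have he1 : 1 - e ∉ Ring.jacobson R := by
    intro h
    obtain ⟨u, -, hu⟩ := isUnit_iff_exists.mp (mem_jac.mp h 1)
    have hu' : u * e = 1 := by rw [← hu]; noncomm_ring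
    apply hne
    have h2 := I.smul_mem u (show e * x ∈ I by simpa using he)
    rwa [smul_eq_mul, ← mul_assoc, hu', one_mul] at h2
  obtain ⟨s, hs, hes⟩ : ∃ s, Soc s ∧ (1 - e) * s ≠ 0 := by
    by_contra hcon
    push Not at hcon
    exact he1 (kasch hinj hcon)
  have : Module.Finite R I := Module.Finite.iff_fg.mpr hI
  obtain ⟨d, hd⟩ := factor hinj (N := I × R) countable_of_fg
    (LinearMap.coprod I.subtype (LinearMap.toSpanSingleton R R x))
    (LinearMap.coprod 0 (LinearMap.toSpanSingleton R R ((1 - e) * s))) (by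
      rintro ⟨i, y⟩ h0
      simp only [LinearMap.coprod_apply, Submodule.subtype_apply,
        LinearMap.toSpanSingleton_apply, LinearMap.zero_apply, zero_add, smul_eq_mul] at h0 ⊢
      have hy : y ∈ I.comap (LinearMap.toSpanSingleton R R x) := by
        simp only [Submodule.mem_comap, LinearMap.toSpanSingleton_apply, smul_eq_mul]
        rw [eq_neg_of_add_eq_zero_right h0]
        exact neg_mem i.2
      have h1 := hs _ (heq y hy)
      have : y * ((1 - e) * s) = -((y * e - y) * s) := by noncomm_ring
      rw [this, h1, neg_zero])
  have hdI : d ∈ rAnn (I : Set R) := by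
    intro i hi
    have := hd (⟨i, hi⟩, 0)
    simpa using this.symm
  have h1 := hd (0, 1)
  simp only [LinearMap.coprod_apply, map_zero, LinearMap.toSpanSingleton_apply, one_smul,
    LinearMap.zero_apply, zero_add] at h1
  exact hes (h1.trans (hx d hdI))

lemma noeth_left [IsNoetherian Rᵐᵒᵖ R] [IsArtinian Rᵐᵒᵖ R] (hinj : IsLeftAleph0Injective R) :
    IsNoetherian R R := by
  refine ⟨fun I => ?_⟩
  obtain ⟨F, hF, hFI, h⟩ := dcc I
  have : F = I := le_antisymm hFI fun x hx => lr hinj F hF x (h x hx)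
  rwa [← this]

lemma right_ext [IsNoetherian Rᵐᵒᵖ R] [IsArtinian Rᵐᵒᵖ R] [IsNoetherian R R]
    (hinj : IsLeftAleph0Injective R) (T : Submodule Rᵐᵒᵖ R) :
    ∀ f : T →ₗ[Rᵐᵒᵖ] R, ∃ x : R, ∀ t : T, f t = x * t := by
  induction T, (IsNoetherian.noetherian T) using Submodule.fg_induction with
  | singleton a =>
    intro f
    have ha : a ∈ Submodule.span Rᵐᵒᵖ {a} := Submodule.mem_span_singleton_self a
    have hm : f ⟨a, ha⟩ ∈ Submodule.span R {a} := by
      apply lr hinj _ (Submodule.fg_span_singleton a)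
      intro t ht
      have h1 : a * t = 0 := ht a (Submodule.mem_span_singleton_self a)
      have h2 : f (MulOpposite.op t • ⟨a, ha⟩) = 0 := by
        have : MulOpposite.op t • (⟨a, ha⟩ : Submodule.span Rᵐᵒᵖ {a}) = 0 := by
          ext; simpa using h1
        rw [this, map_zero]
      rw [map_smul] at h2
      simpa using h2
    obtain ⟨x, hx⟩ := Submodule.mem_span_singleton.mp hm
    refine ⟨x, ?_⟩
    rintro ⟨t, ht⟩
    obtain ⟨c, rfl⟩ := Submodule.mem_span_singleton.mp ht
    have : (⟨c • a, ht⟩ : Submodule.span Rᵐᵒᵖ {a}) = c • ⟨a, ha⟩ := rfl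
    rw [this, map_smul, ← hx]
    simp [MulOpposite.smul_eq_mul_unop, mul_assoc]
  | sup T V hT hV ihT ihV =>
    intro f
    obtain ⟨x, hx⟩ := ihT (f ∘ₗ Submodule.inclusion le_sup_left)
    obtain ⟨y, hy⟩ := ihV (f ∘ₗ Submodule.inclusion le_sup_right)
    have hxy : x - y ∈ lAnn (T : Set R) ⊔ lAnn (V : Set R) := by
      apply lr hinj _ (IsNoetherian.noetherian _)
      intro t ht
      have htT : t ∈ T := rl hinj T t fun w hw => ht w (Submodule.mem_sup_left hw)
      have htV : t ∈ V := rl hinj V t fun w hw => ht w (Submodule.mem_sup_right hw)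
      have h1 := hx ⟨t, htT⟩
      have h2 := hy ⟨t, htV⟩
      rw [sub_mul, sub_eq_zero]
      exact h1.symm.trans h2
    obtain ⟨u, hu, v, hv, huv⟩ := Submodule.mem_sup.mp hxy
    refine ⟨x - u, ?_⟩
    rintro ⟨w, hw⟩
    obtain ⟨t, ht, s, hs, rfl⟩ := Submodule.mem_sup.mp hw
    have h1 : f ⟨t, Submodule.mem_sup_left ht⟩ = x * t := hx ⟨t, ht⟩
    have h2 : f ⟨s, Submodule.mem_sup_right hs⟩ = y * s := hy ⟨s, hs⟩
    have : (⟨t + s, hw⟩ : (T ⊔ V : Submodule Rᵐᵒᵖ R)) =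
      ⟨t, Submodule.mem_sup_left ht⟩ + ⟨s, Submodule.mem_sup_right hs⟩ := rfl
    rw [this, map_add, h1, h2]
    have hut : u * t = 0 := hu t ht
    have hvs : v * s = 0 := hv s hs
    have hxe : x = u + v + y := by rw [huv]; abel
    have h3 : (x - u) * t = x * t := by rw [sub_mul, hut, sub_zero]
    have h4 : (x - u) * s = y * s := by
      rw [hxe]
      have : (u + v + y - u) * s = v * s + y * s := by noncomm_ring
      rw [this, hvs, zero_add]
    change _ = (x - u) * (t + s)
    rw [mul_add, h3, h4]

/-- The map `op` as a homomorphism of right modules. -/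
def opR (R : Type*) [Ring R] : R →ₗ[Rᵐᵒᵖ] Rᵐᵒᵖ where
  toFun := MulOpposite.op
  map_add' := fun _ _ => rfl
  map_smul' := fun c x => by simp [MulOpposite.smul_eq_mul_unop]

end QFAux

/-- If `R` is right noetherian (ACC on right ideals) and left ℵ₀-injective, then
`R` is quasi-Frobenius. -/
theorem quasiFrobenius_of_rightNoetherian_leftAleph0Injective (R : Type*) [Ring R]
    [IsNoetherian Rᵐᵒᵖ R] (hinj : IsLeftAleph0Injective R) :
    IsQuasiFrobenius R := by
  have hart : IsArtinian Rᵐᵒᵖ R := QFAux.artinian_right hinj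
  have hnoe : IsNoetherian R R := QFAux.noeth_left hinj
  have hsp := QFAux.semiprimary hinj
  refine ⟨IsSemiprimaryRing.isNoetherian_iff_isArtinian.mp hnoe, hart, ?_, ?_⟩
  · apply Module.Baer.injective
    intro I f
    obtain ⟨s, hs⟩ := IsNoetherian.noetherian I
    obtain ⟨g, hg⟩ := hinj I ⟨s, s.countable_toSet, hs⟩ f
    exact ⟨g, fun x hx => hg ⟨x, hx⟩⟩
  · apply Module.Baer.injective
    intro I f
    obtain ⟨x, hx⟩ := QFAux.right_ext hinj (Submodule.comap (QFAux.opR R) I) (f ∘ₗ (QFAux.opR R).submoduleComap I)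
    refine ⟨LinearMap.toSpanSingleton Rᵐᵒᵖ R x, fun c hc => ?_⟩
    have h := hx ⟨c.unop, hc⟩
    rw [LinearMap.toSpanSingleton_apply, MulOpposite.smul_eq_mul_unop]
    exact h.symm
end
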